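/- arXiv:1012.4615 — 4 statements merged into one kernel-verified Lean document; each statement's English description precedes it below -/
import Mathlib

section
/- Let $f=\prod_{i=1}^d(x-\alpha_i)$ with pairwise distinct $\alpha_i$ and let $g$ be monic of degree $e$ with $1<d\le e$. Then $\mathrm{Sres}_1(f,g)=(-1)^{d-1}\sum_{i=1}^d\Big(\prod_{j\ne i}\frac{g(\alpha_j)}{\alpha_i-\alpha_j}\Big)(x-\alpha_i)$. -/
open Finset Polynomial

/-- The `t`-th subresultant of `f` and `g` (of formal degrees `d` and `e`), defined as
the determinant of the `(d+e-2t) × (d+e-2t)` Sylvester-type matrix whose first `e-t`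
rows contain the coefficients of `f` (shifted), last column `x^{e-t-1-r} f`, and whose
last `d-t` rows contain the coefficients of `g` (shifted), last column `x^{d-t-1-r'} g`. -/
noncomputable def Sres {K : Type*} [CommRing K] (f g : Polynomial K) (d e t : ℕ) :
    Polynomial K :=
  Matrix.det (Matrix.of fun r c : Fin (d + e - 2 * t) =>
    if (r : ℕ) < e - t then
      if (c : ℕ) = d + e - 2 * t - 1 then X ^ (e - t - 1 - (r : ℕ)) * f
      else if (c : ℕ) ≤ d + (r : ℕ) then Polynomial.C (f.coeff (d + (r : ℕ) - (c : ℕ)))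
      else 0
    else
      if (c : ℕ) = d + e - 2 * t - 1 then X ^ (d - t - 1 - ((r : ℕ) - (e - t))) * g
      else if (c : ℕ) ≤ e + ((r : ℕ) - (e - t)) then
        Polynomial.C (g.coeff (e + ((r : ℕ) - (e - t)) - (c : ℕ)))
      else 0)

section helpers
variable {R : Type*} [CommRing R]

lemma aux_eval (p : R[X]) (n : ℕ) (hp : p.natDegree ≤ n) (x : R) :
    ∑ c : Fin (n + 1), p.coeff (n - (c : ℕ)) * x ^ (n - (c : ℕ)) = p.eval x := by
  rw [Polynomial.eval_eq_sum_range' (Nat.lt_succ_of_le hp), ← Finset.sum_range_reflect,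
    Fin.sum_univ_eq_sum_range (fun c => p.coeff (n - c) * x ^ (n - c))]
  refine Finset.sum_congr rfl fun c hc => ?_
  simp

lemma aux_A (k : ℕ) (p : Fin (k + 1) → R[X]) (hp : ∀ r, (p r).natDegree ≤ k + 1) (ξ : R) :
    Matrix.det (Matrix.of fun r c : Fin (k + 1) =>
      if (c : ℕ) = k then (p r).eval ξ else (p r).coeff (k + 1 - (c : ℕ))) =
    - Matrix.det (Matrix.of fun r c : Fin (k + 2) =>
      ((Fin.snoc p (X - Polynomial.C ξ) : Fin (k + 2) → R[X]) r).coeff (k + 1 - (c : ℕ))) := by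
  set q : Fin (k + 2) → R[X] := Fin.snoc p (X - Polynomial.C ξ) with hq
  have hqd : ∀ r, (q r).natDegree ≤ k + 1 := by
    intro r
    refine Fin.lastCases ?_ (fun r => ?_) r
    · simp only [hq, Fin.snoc_last]
      exact (natDegree_X_sub_C_le ξ).trans (by omega)
    · simpa only [hq, Fin.snoc_castSucc] using hp r
  set U : Matrix (Fin (k + 2)) (Fin (k + 2)) R := Matrix.of fun c c' =>
    if c' = Fin.last (k + 1) then ξ ^ (k + 1 - (c : ℕ)) else if c = c' then 1 else 0 with hU
  have hUdet : U.det = 1 := by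
    rw [Matrix.det_of_upperTriangular]
    · refine Finset.prod_eq_one fun i _ => ?_
      simp only [hU, Matrix.of_apply]
      split_ifs with h
      · subst h; simp
      · rfl
    · intro i j hij
      simp only [id] at hij
      have h1 : j ≠ Fin.last (k + 1) := (hij.trans_le (Fin.le_last i)).ne
      simp [hU, h1, hij.ne']
  rw [← mul_one (Matrix.det (Matrix.of fun r c : Fin (k + 2) => (q r).coeff (k + 1 - (c : ℕ)))),
    ← hUdet, ← Matrix.det_mul]
  have hPU : (Matrix.of fun r c : Fin (k + 2) => (q r).coeff (k + 1 - (c : ℕ))) * U =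
      Matrix.of fun r c : Fin (k + 2) => if c = Fin.last (k + 1) then (q r).eval ξ else
        (q r).coeff (k + 1 - (c : ℕ)) := by
    ext r c : 2
    rw [Matrix.mul_apply]
    simp only [hU, Matrix.of_apply]
    split_ifs with h
    · exact aux_eval (q r) (k + 1) (hqd r) ξ
    · simp
  rw [hPU, Matrix.det_succ_row _ (Fin.last (k + 1)),
    Finset.sum_eq_single (Fin.castSucc (Fin.last k))]
  · have hne : (Fin.castSucc (Fin.last k)) ≠ Fin.last (k + 1) := (Fin.castSucc_lt_last _).ne
    have : (Matrix.of fun r c : Fin (k + 2) => if c = Fin.last (k + 1) then (q r).eval ξ else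
        (q r).coeff (k + 1 - (c : ℕ))).submatrix (Fin.last (k + 1)).succAbove
          (Fin.castSucc (Fin.last k)).succAbove = (Matrix.of fun r c : Fin (k + 1) =>
      if (c : ℕ) = k then (p r).eval ξ else (p r).coeff (k + 1 - (c : ℕ))) := by
      ext r c : 2
      simp only [Matrix.submatrix_apply, Matrix.of_apply, Fin.succAbove_last, hq,
        Fin.snoc_castSucc]
      refine Fin.lastCases ?_ (fun c => ?_) c
      · simp
      · have h1 : (Fin.castSucc (Fin.last k)).succAbove (Fin.castSucc c)
          = Fin.castSucc (Fin.castSucc c) := by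
          apply Fin.succAbove_of_castSucc_lt
          simp [Fin.lt_def]
        rw [h1, if_neg (Fin.castSucc_lt_last _).ne, if_neg (by simpa using c.2.ne)]
        simp
    rw [this]
    simp only [Matrix.of_apply, if_neg hne, hq, Fin.snoc_last]
    have h2 : k + 1 - k = 1 := by omega
    have h3 : (-1 : R) ^ (k + 1 + k) = -1 := by
      rw [Odd.neg_one_pow]; exact ⟨k, by ring⟩
    simp [h2, h3]
  · intro b _ hb
    refine mul_eq_zero_of_left (mul_eq_zero_of_right _ ?_) _
    simp only [Matrix.of_apply, hq, Fin.snoc_last]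
    split_ifs with h
    · simp
    · have h1 : (b : ℕ) ≠ k + 1 := fun h' => h (Fin.ext h')
      have h2 : (b : ℕ) ≠ k := fun h' => hb (Fin.ext h')
      have := b.2
      rw [coeff_sub, coeff_X, coeff_C, if_neg (by omega), if_neg (by omega), sub_zero]
  · simp

lemma aux_B (a m : ℕ) (q : Fin (a + (m + 1)) → R[X]) (hq : ∀ r, (q r).natDegree ≤ a + m)
    (f : R[X]) (hf : f.Monic) (hfd : f.natDegree = m + 1) (α : Fin (m + 1) → R)
    (hfα : ∀ i, f.eval (α i) = 0)
    (hqf : ∀ r : Fin a, q (Fin.castAdd (m + 1) r) = X ^ (a - 1 - (r : ℕ)) * f) :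
    Matrix.det (Matrix.of fun r c : Fin (a + (m + 1)) => (q r).coeff (a + m - (c : ℕ))) *
      Matrix.det (Matrix.of fun k i : Fin (m + 1) => α i ^ (m - (k : ℕ))) =
    Matrix.det (Matrix.of fun k i : Fin (m + 1) => (q (Fin.natAdd a k)).eval (α i)) := by
  set P := (Matrix.of fun r c : Fin (a + (m + 1)) => (q r).coeff (a + m - (c : ℕ))) with hP
  have e1 : P.det = (P.submatrix finSumFinEquiv finSumFinEquiv).det :=
    (Matrix.det_submatrix_equiv_self finSumFinEquiv P).symm
  set Q : Matrix (Fin a ⊕ Fin (m + 1)) (Fin a ⊕ Fin (m + 1)) R :=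
    Matrix.fromBlocks 1 (Matrix.of fun c i => α i ^ (a + m - (c : ℕ))) 0
      (Matrix.of fun k i => α i ^ (m - (k : ℕ))) with hQ
  have e2 : Q.det = Matrix.det (Matrix.of fun k i : Fin (m + 1) => α i ^ (m - (k : ℕ))) := by
    rw [hQ, Matrix.det_fromBlocks_zero₂₁]; simp
  rw [e1, ← e2, ← Matrix.det_mul]
  have hev : ∀ r i, ∑ s : Fin a ⊕ Fin (m + 1),
      (P.submatrix finSumFinEquiv finSumFinEquiv) r s * Q s (Sum.inr i)
      = (q (finSumFinEquiv r)).eval (α i) := by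
    intro r i
    rw [← aux_eval (q (finSumFinEquiv r)) (a + m) (hq _) (α i)]
    refine Fintype.sum_equiv finSumFinEquiv _ _ fun s => ?_
    rcases s with s | s
    · simp [hP, hQ]
    · simp [hP, hQ, Nat.add_sub_add_left]
  have hPQ : P.submatrix finSumFinEquiv finSumFinEquiv * Q = Matrix.fromBlocks
      (Matrix.of fun r c : Fin a => (X ^ (a - 1 - (r : ℕ)) * f).coeff (a + m - (c : ℕ)))
      0
      (Matrix.of fun (r : Fin (m + 1)) (c : Fin a) =>
        (q (Fin.natAdd a r)).coeff (a + m - (c : ℕ)))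
      (Matrix.of fun k i : Fin (m + 1) => (q (Fin.natAdd a k)).eval (α i)) := by
    ext r c : 2
    rw [Matrix.mul_apply]
    rcases c with c | c
    · rw [Fintype.sum_sum_type]
      rcases r with r | r
      · simp [hP, hQ, Matrix.one_apply, hqf]
      · simp [hP, hQ, Matrix.one_apply]
    · rw [hev]
      rcases r with r | r
      · simp [hqf, hfα]
      · simp
  rw [hPQ, Matrix.det_fromBlocks_zero₁₂, Matrix.det_of_upperTriangular, Finset.prod_eq_one,
    one_mul]
  · intro r _
    have := r.2
    rw [Matrix.of_apply, coeff_X_pow_mul', if_pos (by omega),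
      show a + m - (r : ℕ) - (a - 1 - r) = m + 1 by omega, ← hfd]
    exact hf
  · intro r c hrc
    simp only [id] at hrc
    have := r.2
    have h2 : (c : ℕ) < r := hrc
    rw [Matrix.of_apply, coeff_X_pow_mul', if_pos (by omega)]
    exact coeff_eq_zero_of_natDegree_lt (by omega)

lemma aux_V (m : ℕ) (α : Fin (m + 1) → R) :
    Matrix.det (Matrix.of fun k i : Fin (m + 1) => α i ^ (m - (k : ℕ))) =
      ∏ i : Fin (m + 1), ∏ j ∈ Finset.Ioi i, (α i - α j) := by
  have := Matrix.det_projVandermonde (1 : Fin (m + 1) → R) α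
  rw [← Matrix.det_transpose] at this
  simp only [Pi.one_apply, one_mul] at this
  rw [← this]
  congr 1
  ext k i : 2
  simp only [Matrix.transpose_apply, Matrix.of_apply, Matrix.projVandermonde_apply, Fin.val_rev,
    Pi.one_apply, one_pow, one_mul]
  congr 1
  omega

lemma aux_V_succ (m : ℕ) (α : Fin (m + 2) → R) (i : Fin (m + 2)) :
    Matrix.det (Matrix.of fun k i : Fin (m + 2) => α i ^ (m + 1 - (k : ℕ))) =
    (-1) ^ (i : ℕ) * (∏ j ∈ Finset.univ.erase i, (α i - α j)) *
    Matrix.det (Matrix.of fun k j : Fin (m + 1) => α (i.succAbove j) ^ (m - (k : ℕ))) := by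
  have h := Matrix.det_permute' i.cycleRange.symm
    (Matrix.of fun k i : Fin (m + 2) => α i ^ (m + 1 - (k : ℕ)))
  have h2 := aux_V (m + 1) (fun j => α (i.cycleRange.symm j))
  have h3 : (Matrix.of fun k i : Fin (m + 2) => α i ^ (m + 1 - (k : ℕ))).submatrix id
      i.cycleRange.symm = Matrix.of fun k j : Fin (m + 2) =>
        (fun j => α (i.cycleRange.symm j)) j ^ (m + 1 - (k : ℕ)) := rfl
  rw [h3, h2, Fin.prod_univ_succ] at h
  have h4 : ∏ j ∈ Finset.univ.erase i, (α i - α j) = ∏ j, (α i - α (i.succAbove j)) := by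
    rw [← Finset.compl_singleton, ← Fin.image_succAbove_univ,
      Finset.prod_image (fun _ _ _ _ h => Fin.succAbove_right_injective h)]
  have h5 := aux_V m (fun j => α (i.succAbove j))
  simp only [Fin.cycleRange_symm_zero, Fin.cycleRange_symm_succ, Fin.prod_Ioi_zero,
    Fin.prod_Ioi_succ, Equiv.Perm.sign_symm, Fin.sign_cycleRange] at h
  rw [h4, h5, mul_assoc, h]
  push_cast
  rw [← mul_assoc, ← mul_pow]
  simp

end helpers

/-- the row polynomials of the subresultant matrix -/
noncomputable def rowPoly {R : Type*} [CommRing R] (f g : R[X]) (a m : ℕ) (r : ℕ) : R[X] :=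
  if r < a then X ^ (a - 1 - r) * f else X ^ (m - (r - a)) * g

lemma aux_S {R : Type*} [CommRing R] (f g : R[X]) (a m : ℕ) :
    Sres f g (m + 2) (a + 1) 1 = Matrix.det (Matrix.of fun r c : Fin (a + m + 1) =>
      if (c : ℕ) = a + m then rowPoly f g a m r
      else Polynomial.C ((rowPoly f g a m r).coeff (a + m + 1 - (c : ℕ)))) := by
  have hn : a + m + 1 = m + 2 + (a + 1) - 2 * 1 := by omega
  rw [Sres, ← Matrix.det_submatrix_equiv_self (finCongr hn)]
  congr 1
  ext r c : 2
  have hr := r.2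
  have hc := c.2
  simp only [Matrix.submatrix_apply, Matrix.of_apply, finCongr_apply, Fin.val_cast, rowPoly]
  rw [show m + 2 + (a + 1) - 2 * 1 - 1 = a + m by omega, Nat.add_sub_cancel]
  by_cases h1 : (r : ℕ) < a
  · simp only [if_pos h1]
    by_cases h2 : (c : ℕ) = a + m
    · simp only [if_pos h2]
    · simp only [if_neg h2, coeff_X_pow_mul']
      by_cases h3 : (c : ℕ) ≤ m + 2 + r
      · rw [if_pos h3, if_pos (by omega)]
        rw [show m + 2 + (r : ℕ) - c = a + m + 1 - c - (a - 1 - r) by omega]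
      · rw [if_neg h3, if_neg (by omega), Polynomial.C_0]
  · simp only [if_neg h1]
    by_cases h2 : (c : ℕ) = a + m
    · simp only [if_pos h2]
      rw [show m + 2 - 1 - 1 - ((r : ℕ) - a) = m - (r - a) by omega]
    · simp only [if_neg h2, coeff_X_pow_mul']
      by_cases h3 : (c : ℕ) ≤ a + 1 + (r - a)
      · rw [if_pos h3, if_pos (by omega)]
        rw [show a + 1 + ((r : ℕ) - a) - c = a + m + 1 - c - (m - (r - a)) by omega]
      · rw [if_neg h3, if_neg (by omega), Polynomial.C_0]

lemma aux_main {K : Type*} [Field K] (m a : ℕ)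
    (α : Fin (m + 2) → K) (hα : Function.Injective α)
    (g : Polynomial K) (hge : g.natDegree = a + 1) :
    Sres (∏ i, (X - Polynomial.C (α i))) g (m + 2) (a + 1) 1 =
      (-1 : Polynomial K) ^ (m + 1) *
        ∑ i, Polynomial.C (∏ j ∈ Finset.univ.erase i,
            (Polynomial.eval (α j) g / (α i - α j))) *
          (X - Polynomial.C (α i)) := by
  set f : K[X] := ∏ i, (X - Polynomial.C (α i)) with hf
  have hfm : f.Monic := monic_prod_of_monic _ _ fun i _ => monic_X_sub_C _
  have hfd : f.natDegree = m + 2 := by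
    rw [hf, natDegree_prod_of_monic _ _ fun i _ => monic_X_sub_C _]; simp
  have hfα : ∀ i, f.eval (α i) = 0 := by
    intro i
    rw [hf, eval_prod]
    exact Finset.prod_eq_zero (Finset.mem_univ i) (by simp)
  set p : Fin (a + m + 1) → K[X][X] := fun r => (rowPoly f g a m r).map Polynomial.C with hp
  have hpd : ∀ r, (p r).natDegree ≤ a + m + 1 := by
    intro r
    have := r.2
    refine natDegree_map_le.trans ?_
    rw [rowPoly]
    split_ifs with h
    · refine natDegree_mul_le.trans ?_
      rw [natDegree_X_pow]; omega
    · refine natDegree_mul_le.trans ?_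
      rw [natDegree_X_pow]; omega
  have hA := aux_A (a + m) p hpd X
  have hS : Sres f g (m + 2) (a + 1) 1 = Matrix.det (Matrix.of fun r c : Fin (a + m + 1) =>
      if (c : ℕ) = a + m then (p r).eval X else (p r).coeff (a + m + 1 - (c : ℕ))) := by
    rw [aux_S]
    congr 1
    ext r c : 2
    simp only [Matrix.of_apply, hp, coeff_map, eval_map, eval₂_C_X]
  rw [← hS] at hA
  set q : Fin (a + m + 2) → K[X][X] := Fin.snoc p (X - Polynomial.C X) with hq
  have hqd : ∀ r, (q r).natDegree ≤ a + (m + 1) := by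
    intro r
    refine Fin.lastCases ?_ (fun r => ?_) r
    · simp only [hq, Fin.snoc_last]
      exact (natDegree_X_sub_C_le _).trans (by omega)
    · simp only [hq, Fin.snoc_castSucc]
      exact hpd r
  have hqlast : q (Fin.natAdd a (Fin.last (m + 1))) = X - Polynomial.C X := by
    have : (Fin.natAdd a (Fin.last (m + 1)) : Fin (a + (m + 1 + 1))) = Fin.last (a + m + 1) := rfl
    rw [this, hq, Fin.snoc_last]
  have hqg : ∀ k : Fin (m + 1), q (Fin.natAdd a (Fin.castSucc k)) =
      (X ^ (m - (k : ℕ)) * g).map Polynomial.C := by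
    intro k
    have : (Fin.natAdd a (Fin.castSucc k) : Fin (a + (m + 1 + 1))) =
      Fin.castSucc (Fin.natAdd a k : Fin (a + (m + 1))) := rfl
    rw [this, hq]
    erw [Fin.snoc_castSucc]
    simp [hp, rowPoly]
  have hqf : ∀ k : Fin a, q (Fin.castAdd (m + 1 + 1) k) =
      X ^ (a - 1 - (k : ℕ)) * f.map Polynomial.C := by
    intro k
    have : (Fin.castAdd (m + 1 + 1) k : Fin (a + (m + 1 + 1))) =
      Fin.castSucc (Fin.castAdd (m + 1) k : Fin (a + (m + 1))) := rfl
    rw [this, hq]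
    erw [Fin.snoc_castSucc]
    simp [hp, rowPoly]
  have hB := aux_B a (m + 1) q hqd (f.map Polynomial.C) (hfm.map _)
    (by rw [hfm.natDegree_map, hfd]) (fun i => Polynomial.C (α i))
    (fun i => by rw [eval_map, eval₂_at_apply, hfα, map_zero]) hqf
  have hA' : Matrix.det (Matrix.of fun r c : Fin (a + (m + 1 + 1)) =>
      (q r).coeff (a + (m + 1) - (c : ℕ))) = - Sres f g (m + 2) (a + 1) 1 := by
    rw [hA, neg_neg]; rfl
  rw [hA'] at hB
  set V := Matrix.det (Matrix.of fun k i : Fin (m + 1 + 1) =>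
    (fun i => Polynomial.C (α i)) i ^ (m + 1 - (k : ℕ))) with hV
  have hV0 : V ≠ 0 := by
    rw [hV, aux_V]
    refine Finset.prod_ne_zero_iff.2 fun i _ => Finset.prod_ne_zero_iff.2 fun j hj => ?_
    rw [← map_sub]
    refine Polynomial.C_ne_zero.2 (sub_ne_zero.2 fun h => ?_)
    exact (Finset.mem_Ioi.1 hj).ne (hα h)
  have hW : Matrix.det (Matrix.of fun k i : Fin (m + 1 + 1) =>
      (q (Fin.natAdd a k)).eval (Polynomial.C (α i))) =
      ∑ i, (-1) ^ (m + 1) * V * (Polynomial.C (∏ j ∈ Finset.univ.erase i,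
            (Polynomial.eval (α j) g / (α i - α j))) * (Polynomial.C (α i) - X)) := by
    rw [Matrix.det_succ_row _ (Fin.last (m + 1))]
    refine Finset.sum_congr rfl fun i _ => ?_
    rw [Matrix.of_apply, hqlast]
    have hsub : (Matrix.of fun k i : Fin (m + 1 + 1) =>
      (q (Fin.natAdd a k)).eval (Polynomial.C (α i))).submatrix (Fin.last (m + 1)).succAbove
        i.succAbove = Matrix.of fun k j : Fin (m + 1) =>
          (fun j => Polynomial.C (g.eval (α (i.succAbove j)))) j *
          (Matrix.of fun k j : Fin (m + 1) =>
            (fun i => Polynomial.C (α i)) (i.succAbove j) ^ (m - (k : ℕ))) k j := by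
      ext k j : 2
      simp only [Matrix.submatrix_apply, Matrix.of_apply, Fin.succAbove_last, hqg]
      rw [eval_map, eval₂_at_apply]
      simp [mul_comm]
    rw [hsub, Matrix.det_mul_row]
    have hVi := aux_V_succ m (fun i => Polynomial.C (α i)) i
    rw [← hV] at hVi
    have h4 : ∀ F : Fin (m + 2) → K[X],
        ∏ j ∈ Finset.univ.erase i, F j = ∏ j, F (i.succAbove j) := by
      intro F
      rw [← Finset.compl_singleton, ← Fin.image_succAbove_univ,
        Finset.prod_image (fun _ _ _ _ h => Fin.succAbove_right_injective h)]
    rw [hVi, ← h4 (fun j => Polynomial.C (g.eval (α j)))]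
    have h6 : ∏ j ∈ Finset.univ.erase i, Polynomial.C (eval (α j) g) =
        (∏ j ∈ Finset.univ.erase i, (Polynomial.C (α i) - Polynomial.C (α j))) *
        Polynomial.C (∏ j ∈ Finset.univ.erase i, (Polynomial.eval (α j) g / (α i - α j))) := by
      rw [map_prod, ← Finset.prod_mul_distrib]
      refine Finset.prod_congr rfl fun j hj => ?_
      rw [← map_sub, ← map_mul]
      congr 1
      have : α i - α j ≠ 0 := sub_ne_zero.2 fun h => (Finset.ne_of_mem_erase hj) (hα h).symm
      field_simp
    rw [h6]
    simp only [eval_sub, eval_X, eval_C, Fin.val_last, pow_add]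
    ring
  rw [hW, ← Finset.mul_sum] at hB
  have hfin : ∑ i, (Polynomial.C (∏ j ∈ Finset.univ.erase i,
            (Polynomial.eval (α j) g / (α i - α j))) * (Polynomial.C (α i) - X)) =
      - ∑ i, (Polynomial.C (∏ j ∈ Finset.univ.erase i,
            (Polynomial.eval (α j) g / (α i - α j))) * (X - Polynomial.C (α i))) := by
    rw [← Finset.sum_neg_distrib]
    exact Finset.sum_congr rfl fun i _ => by ring
  rw [hfin] at hB
  apply mul_right_cancel₀ hV0
  linear_combination -hB

/-- For `f` with simple roots `α₁,…,α_d` and monic `g` of degree `e`, `1 < d ≤ e`: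
`Sres₁(f,g) = (-1)^{d-1} ∑ᵢ (∏_{j≠i} g(αⱼ)/(αᵢ-αⱼ)) (x - αᵢ)`. -/
theorem sres_one_simple_roots {K : Type*} [Field K] [CharZero K] {d : ℕ}
    (α : Fin d → K) (hα : Function.Injective α) (e : ℕ) (hd : 1 < d) (hde : d ≤ e)
    (g : Polynomial K) (hg : g.Monic) (hge : g.natDegree = e) :
    Sres (∏ i, (X - Polynomial.C (α i))) g d e 1 =
      (-1 : Polynomial K) ^ (d - 1) *
        ∑ i, Polynomial.C (∏ j ∈ Finset.univ.erase i,
            (Polynomial.eval (α j) g / (α i - α j))) *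
          (X - Polynomial.C (α i)) := by
  obtain ⟨m, rfl⟩ : ∃ m, d = m + 2 := ⟨d - 2, by omega⟩
  obtain ⟨a, rfl⟩ : ∃ a, e = a + 1 := ⟨e - 1, by omega⟩
  exact aux_main m a α hα g hge
end

section
/- For $\overline{f}=(x-\alpha)^d$ with $d\ge 2$ and $\overline{g}=\prod_{\ell=1}^n(x-\beta_\ell)^{e_\ell}$ of degree $e\ge d$ with all $\beta_\ell\ne\alpha$: $\mathrm{Sres}_1((x-\alpha)^d,\overline{g})=\overline{g}(\alpha)^{d-1}\Big(\sum_{k_1+\cdots+k_n=d-1}\prod_{\ell=1}^n\frac{\binom{e_\ell-1+k_\ell}{k_\ell}}{(\alpha-\beta_\ell)^{k_\ell}}\,(x-\alpha)+\sum_{k_1+\cdots+k_n=d-2}\prod_{\ell=1}^n\frac{\binom{e_\ell-1+k_\ell}{k_\ell}}{(\alpha-\beta_\ell)^{k_\ell}}\Big)$. -/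
open Finset Polynomial

/-- The tuples `(k₁,…,k_n)` of nonnegative integers summing to `k`. -/
def sumTuples (n : ℕ) (k : ℕ) : Finset (Fin n → ℕ) :=
  (Fintype.piFinset fun _ : Fin n => Finset.range (k + 1)).filter
    fun κ => ∑ ℓ, κ ℓ = k

lemma toeplitz_det {R : Type*} [CommRing R] [IsDomain R] (m : ℕ) (γ v : ℕ → R) (Y : R)
    (h0 : γ 0 ≠ 0)
    (hv : ∀ i, ∑ c ∈ range (i+1), γ (i - c) * v c = if i = 0 then γ 0 else 0) :
    Matrix.det (Matrix.of fun r c : Fin (m+1) =>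
      if (c:ℕ) = m then (if m ≤ 1 + (r:ℕ) then γ (1 + r - m) else 0) * Y
          + (if m ≤ (r:ℕ) then γ (r - m) else 0)
      else if (c:ℕ) ≤ 1 + r then γ (1 + r - c) else 0)
    = γ 0 ^ (m+1) * ((-1)^(m+1) * v (m+1) * Y + (-1)^m * v m) := by
  set A : Matrix (Fin (m+2)) (Fin (m+2)) R :=
    Matrix.of fun i c => if (c:ℕ) ≤ i then γ (i - c) else 0 with hA
  have hdet : A.det = γ 0 ^ (m+2) := by
    rw [Matrix.det_of_isLowerTriangular]
    · simp [hA]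
    · intro i j hij
      simp only [hA, Matrix.of_apply]
      rw [if_neg]
      have : i < j := hij
      simpa using this
  have hAv : A.mulVec (fun i => v i) = Pi.single 0 (γ 0) := by
    ext i
    simp only [Matrix.mulVec, dotProduct, hA, Matrix.of_apply]
    have h1 := hv i
    rw [Fin.sum_univ_eq_sum_range (fun c => (if c ≤ (i:ℕ) then γ (i - c) else 0) * v c) (m+2)]
    have h2 : ∑ c ∈ range (m+2), (if c ≤ (i:ℕ) then γ (i - c) else 0) * v c
        = ∑ c ∈ range (i+1), γ (i - c) * v c := by
      rw [← Finset.sum_subset (s₁ := range ((i:ℕ)+1))]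
      · apply Finset.sum_congr rfl
        intro c hc
        rw [if_pos (by simp at hc; omega)]
      · intro c hc
        simp at hc ⊢
        omega
      · intro c _ hc
        rw [if_neg (by simp at hc; omega), zero_mul]
    rw [h2, h1]
    by_cases hi : i = 0
    · subst hi; simp
    · rw [Pi.single_eq_of_ne hi, if_neg]
      intro h; exact hi (Fin.ext h)
  have hadj : ∀ k, A.adjugate k 0 = γ 0 ^ (m+1) * v k := by
    intro k
    have h : A.adjugate.mulVec (A.mulVec (fun i => v i)) k = A.det * v k := by
      rw [Matrix.mulVec_mulVec, Matrix.adjugate_mul, Matrix.smul_mulVec, Matrix.one_mulVec]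
      rfl
    rw [hAv, hdet] at h
    simp at h
    apply mul_right_cancel₀ h0
    rw [h]; ring
  set M1 : Matrix (Fin (m+1)) (Fin (m+1)) R := A.submatrix (Fin.succAbove 0) (Fin.succAbove (Fin.last (m+1))) with hM1
  have e1 := hadj (Fin.last (m+1))
  have e2 := hadj (Fin.last m).castSucc
  rw [Matrix.adjugate_fin_succ_eq_det_submatrix] at e1 e2
  set u1 : Fin (m+1) → R := fun r => (if m ≤ 1 + (r:ℕ) then γ (1 + r - m) else 0)
  set u2 : Fin (m+1) → R := fun r => (if m ≤ (r:ℕ) then γ (r - m) else 0)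
  have key : (Matrix.of fun r c : Fin (m+1) =>
      if (c:ℕ) = m then (if m ≤ 1 + (r:ℕ) then γ (1 + r - m) else 0) * Y
          + (if m ≤ (r:ℕ) then γ (r - m) else 0)
      else if (c:ℕ) ≤ 1 + r then γ (1 + r - c) else 0)
      = M1.updateCol (Fin.last m) (Y • u1 + u2) := by
    ext r c
    by_cases hc : c = Fin.last m
    · subst hc
      simp [u1, u2, mul_comm]
    · have : (c:ℕ) ≠ m := fun h => hc (Fin.ext h)
      simp [hc, this, hM1, hA, add_comm]
      simp only [Fin.le_def, Fin.val_castSucc, Fin.val_succ]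
  have k1 : M1.updateCol (Fin.last m) u1 = M1 := by
    ext r c
    by_cases hc : c = Fin.last m
    · subst hc
      simp [u1, hM1, hA, add_comm]
      simp only [Fin.le_def, Fin.val_castSucc, Fin.val_succ, Fin.val_last]
    · simp [hc]
  have k2 : M1.updateCol (Fin.last m) u2 = A.submatrix (Fin.succAbove 0) (Fin.succAbove (Fin.last m).castSucc) := by
    ext r c
    by_cases hc : c = Fin.last m
    · subst hc
      have : r = Fin.last m ↔ m ≤ r := by rw [Fin.ext_iff, Fin.val_last]; omega
      simp [u2, hA, this]
    · have h3 : (Fin.last m).castSucc.succAbove c = c.castSucc := by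
        apply Fin.succAbove_of_castSucc_lt
        simp [Fin.lt_def]
        have : (c:ℕ) ≠ m := fun h => hc (Fin.ext h)
        omega
      simp [hc, hM1, hA, h3]
  rw [key, Matrix.det_updateCol_add, Matrix.det_updateCol_smul, k1, k2]
  simp only [Fin.val_last, Fin.val_castSucc, Fin.val_zero, zero_add] at e1 e2
  have s : ∀ k : ℕ, ((-1:R)^k) * (-1)^k = 1 := by intro k; rw [← mul_pow]; simp
  have f1 : M1.det = (-1)^(m+1) * (γ 0 ^ (m+1) * v (m+1)) := by
    rw [← e1, ← mul_assoc, s, one_mul]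
  have f2 : (A.submatrix (Fin.succAbove 0) (Fin.succAbove (Fin.last m).castSucc)).det = (-1)^m * (γ 0 ^ (m+1) * v m) := by
    rw [← e2, ← mul_assoc, s, one_mul]
  rw [f1, f2]; ring

lemma series_inv {K : Type*} [Field K] (b : K) (hb : b ≠ 0) (e : ℕ) (he : 1 ≤ e) :
    (PowerSeries.X + PowerSeries.C b) ^ e *
      PowerSeries.mk (fun k => (-1)^k * (((e - 1 + k).choose k : K) / b ^ k)) = PowerSeries.C (b^e) := by
  have h1 := (PowerSeries.invOneSubPow K e).inv_val
  rw [PowerSeries.invOneSubPow_inv_eq_one_sub_pow,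
    PowerSeries.invOneSubPow_val_eq_mk_sub_one_add_choose_of_pos _ _ he] at h1
  have h2 := congrArg (PowerSeries.rescale (-b⁻¹)) h1
  rw [map_mul, map_pow, map_sub, map_one, PowerSeries.rescale_X] at h2
  have h3 : PowerSeries.rescale (-b⁻¹) (PowerSeries.mk fun n => ((e - 1 + n).choose (e-1) : K))
     = PowerSeries.mk (fun k => (-1)^k * (((e - 1 + k).choose k : K) / b ^ k)) := by
    ext k
    simp only [PowerSeries.coeff_rescale, PowerSeries.coeff_mk]
    rw [Nat.choose_symm_add, neg_pow, inv_pow]; ring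
  rw [h3] at h2
  have h4 : (PowerSeries.X + PowerSeries.C b : PowerSeries K) = PowerSeries.C b * (1 - PowerSeries.C (-b⁻¹) * PowerSeries.X) := by
    rw [mul_sub, ← mul_assoc, ← map_mul]
    simp [hb]; ring
  rw [h4, mul_pow, mul_assoc, h2]; simp

lemma conv_inv {K : Type*} [Field K] {n : ℕ} (b : Fin n → K) (hb : ∀ ℓ, b ℓ ≠ 0) (ee : Fin n → ℕ)
    (hee : ∀ ℓ, 1 ≤ ee ℓ) (i : ℕ) :
    ∑ c ∈ range (i+1), (∏ ℓ, (X + C (b ℓ)) ^ ee ℓ : K[X]).coeff (i - c) *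
      ((-1)^c * ∑ κ ∈ sumTuples n c, ∏ ℓ, ((ee ℓ - 1 + κ ℓ).choose (κ ℓ) : K) / (b ℓ) ^ (κ ℓ))
    = if i = 0 then (∏ ℓ, (X + C (b ℓ)) ^ ee ℓ : K[X]).coeff 0 else 0 := by
  have h1 : PowerSeries.mk (fun c => ((-1)^c * ∑ κ ∈ sumTuples n c, ∏ ℓ, ((ee ℓ - 1 + κ ℓ).choose (κ ℓ) : K) / (b ℓ) ^ (κ ℓ)))
      = ∏ ℓ, PowerSeries.mk (fun k => (-1)^k * (((ee ℓ - 1 + k).choose k : K) / b ℓ ^ k)) := by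
    ext c
    rw [PowerSeries.coeff_prod, PowerSeries.coeff_mk, Finset.mul_sum]
    symm
    refine Finset.sum_bij (fun l _ => (l : Fin n → ℕ)) ?_ ?_ ?_ ?_
    · intro l hl
      simp [sumTuples] at hl ⊢
      refine ⟨fun a => ?_, hl⟩
      have := Finset.single_le_sum (f := fun i => l i) (fun i _ => Nat.zero_le _) (Finset.mem_univ a)
      change ∑ x, l x = c at hl
      omega
    · intro a _ b _ h
      exact DFunLike.coe_injective h
    · intro κ hκ
      refine ⟨Finsupp.equivFunOnFinite.symm κ, ?_, ?_⟩
      · simp [sumTuples] at hκ ⊢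
        exact hκ.2
      · simp
    · intro l hl
      simp at hl
      simp only [PowerSeries.coeff_mk]
      rw [Finset.prod_mul_distrib, Finset.prod_pow_eq_pow_sum, hl]
  have h2 : ((∏ ℓ, (X + C (b ℓ)) ^ ee ℓ : K[X]) : PowerSeries K) *
     PowerSeries.mk (fun c => ((-1)^c * ∑ κ ∈ sumTuples n c, ∏ ℓ, ((ee ℓ - 1 + κ ℓ).choose (κ ℓ) : K) / (b ℓ) ^ (κ ℓ)))
     = PowerSeries.C (∏ ℓ, b ℓ ^ ee ℓ) := by
    rw [h1]
    have : ((∏ ℓ, (X + C (b ℓ)) ^ ee ℓ : K[X]) : PowerSeries K) = ∏ ℓ, (PowerSeries.X + PowerSeries.C (b ℓ)) ^ ee ℓ := by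
      rw [← Polynomial.coeToPowerSeries.ringHom_apply, map_prod]
      simp
    rw [this, ← Finset.prod_mul_distrib, map_prod]
    exact Finset.prod_congr rfl fun ℓ _ => series_inv _ (hb ℓ) _ (hee ℓ)
  have h3 := congrArg (PowerSeries.coeff i) h2
  rw [PowerSeries.coeff_mul, PowerSeries.coeff_C, Finset.Nat.sum_antidiagonal_eq_sum_range_succ_mk] at h3
  simp only [PowerSeries.coeff_mk, Polynomial.coeff_coe] at h3
  have h4 : (∏ ℓ, (X + C (b ℓ)) ^ ee ℓ : K[X]).coeff 0 = ∏ ℓ, b ℓ ^ ee ℓ := by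
    rw [Polynomial.coeff_zero_eq_eval_zero, Polynomial.eval_prod]; simp
  rw [h4, ← h3, ← Finset.sum_range_reflect]
  apply Finset.sum_congr rfl
  intro c hc
  have : c ≤ i := by simp at hc; omega
  simp [Nat.sub_sub_self this]

lemma det_cast_nat {R : Type*} [CommRing R] {N N' : ℕ} (h : N = N') (F : ℕ → ℕ → R) :
    Matrix.det (Matrix.of fun r c : Fin N => F r c) =
      Matrix.det (Matrix.of fun r c : Fin N' => F r c) := by
  subst h; rfl

/-- determinant of coefficients of the rows `P`, last column replaced by the polynomials. -/
noncomputable def matN {K : Type*} [CommRing K] (q : ℕ) (P : ℕ → K[X]) : K[X] :=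
  Matrix.det (Matrix.of fun r c : Fin (q + 1) =>
    if (c : ℕ) = q then P r else C ((P r).coeff (q + 1 - c)))

lemma matN_row {K : Type*} [CommRing K] (q : ℕ) (P P' : ℕ → K[X]) (l : ℕ → ℕ → K)
    (h0 : ∀ r r', r' < r → l r r' = 0) (h1 : ∀ r, l r r = 1)
    (h : ∀ r, r < q + 1 → P r = ∑ r' ∈ range (q + 1), C (l r r') * P' r') :
    matN q P = matN q P' := by
  unfold matN
  set L : Matrix (Fin (q+1)) (Fin (q+1)) K[X] := Matrix.of fun r c => C (l r c) with hL
  have hdet : L.det = 1 := by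
    rw [Matrix.det_of_isUpperTriangular]
    · simp [hL, h1]
    · intro i j hij
      have : (j:ℕ) < i := hij
      simp [hL, h0 _ _ this]
  rw [← one_mul (Matrix.det (Matrix.of fun r c : Fin (q + 1) =>
    if (c : ℕ) = q then P' r else C ((P' r).coeff (q + 1 - c)))), ← hdet, ← Matrix.det_mul]
  congr 1
  ext1 r c
  rw [Matrix.mul_apply]
  simp only [Matrix.of_apply, hL]
  by_cases hc : (c:ℕ) = q
  · simp only [hc, if_true]
    rw [h r r.2, Fin.sum_univ_eq_sum_range (fun r' => C (l r r') * P' r')]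
  · simp only [hc, if_false]
    rw [h r r.2, Fin.sum_univ_eq_sum_range (fun r' => C (l r r') * C ((P' r').coeff (q+1-c)))]
    simp

lemma taylor_expand {K : Type*} [CommRing K] (α : K) (p : K[X]) (n : ℕ) (hp : p.natDegree < n) :
    p = ∑ j ∈ range n, C ((taylor α p).coeff j) * (X - C α) ^ j := by
  conv_lhs => rw [← Polynomial.sum_taylor_eq p α]
  rw [Polynomial.sum_over_range' _ _ n]
  · rwa [natDegree_taylor]
  · simp

lemma matN_col {K : Type*} [Field K] (q : ℕ) (P : ℕ → K[X]) (α : K)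
    (hP : ∀ r, r < q + 1 → (P r).natDegree < q + 2) :
    matN q P = Matrix.det (Matrix.of fun r c : Fin (q + 1) =>
      if (c : ℕ) = q then C ((taylor α (P r)).coeff 1) * (X - C α) + C ((taylor α (P r)).coeff 0)
      else C ((taylor α (P r)).coeff (q + 1 - c))) := by
  unfold matN
  set T : Matrix (Fin (q+1)) (Fin (q+1)) K[X] := Matrix.of fun c' c =>
    if (c:ℕ) = q then (if (c':ℕ) = q then 1 else (X - C α) ^ (q + 1 - c'))
    else C (((X - C α) ^ (q + 1 - (c':ℕ))).coeff (q + 1 - c)) with hT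
  have hdeg : ∀ j : ℕ, ((X - C α) ^ j).natDegree = j := fun j => by
    rw [(monic_X_sub_C α).natDegree_pow, natDegree_X_sub_C, mul_one]
  have hdet : T.det = 1 := by
    rw [Matrix.det_of_isUpperTriangular]
    · apply Finset.prod_eq_one
      intro i _
      simp only [hT, Matrix.of_apply]
      split_ifs
      · rfl
      · have h := ((monic_X_sub_C α).pow (q + 1 - (i:ℕ))).coeff_natDegree
        rw [hdeg] at h
        rw [h, C_1]
    · intro i j hij
      have hlt : (j:ℕ) < i := hij
      simp only [hT, Matrix.of_apply]
      rw [if_neg (by omega), coeff_eq_zero_of_natDegree_lt, C_0]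
      rw [hdeg]; omega
  rw [← mul_one (Matrix.det (Matrix.of fun r c : Fin (q + 1) =>
      if (c : ℕ) = q then C ((taylor α (P r)).coeff 1) * (X - C α) + C ((taylor α (P r)).coeff 0)
      else C ((taylor α (P r)).coeff (q + 1 - c)))), ← hdet, ← Matrix.det_mul]
  congr 1
  ext1 r c
  rw [Matrix.mul_apply]
  have hex := taylor_expand α (P r) (q+2) (hP r r.2)
  rw [Finset.sum_range_succ', Finset.sum_range_succ', ← Finset.sum_range_reflect] at hex
  rw [Fin.sum_univ_castSucc]
  simp only [Matrix.of_apply, hT, Fin.val_castSucc, Fin.val_last, if_true]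
  have hne : ∀ x : Fin q, (x:ℕ) ≠ q := fun x => by omega
  simp only [hne, if_false]
  by_cases hc : (c:ℕ) = q
  · simp only [hc, if_true]
    rw [Fin.sum_univ_eq_sum_range (fun x => C ((taylor α (P r)).coeff (q + 1 - x)) * (X - C α) ^ (q+1-x))]
    conv_lhs => rw [hex]
    have : ∀ x ∈ range q, q - 1 - x + 1 + 1 = q + 1 - x := by
      intro x hx; simp at hx; omega
    rw [Finset.sum_congr rfl fun x hx => by rw [this x hx]]
    simp; ring
  · simp only [hc, if_false]
    rw [Fin.sum_univ_eq_sum_range (fun x => C ((taylor α (P r)).coeff (q + 1 - x)) * C (((X - C α : K[X]) ^ (q+1-x)).coeff (q+1-(c:ℕ))) : ℕ → K[X])]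
    conv_lhs => rw [hex]
    have : ∀ x ∈ range q, q - 1 - x + 1 + 1 = q + 1 - x := by
      intro x hx; simp at hx; omega
    rw [Finset.sum_congr rfl fun x hx => by rw [this x hx]]
    have z1 : ∀ j, j ≤ 1 → ((X - C α) ^ j).coeff (q + 1 - c) = 0 := by
      intro j hj
      apply coeff_eq_zero_of_natDegree_lt
      rw [hdeg]; omega
    have e1 : q + 1 - q = 1 := by omega
    rw [e1, z1 1 le_rfl]
    simp only [zero_add, coeff_add, coeff_C_mul, finsetSum_coeff, z1 1 le_rfl, z1 0 (Nat.zero_le _),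
      mul_zero, add_zero, C_0, map_sum, C_mul]

lemma X_pow_expand {K : Type*} [CommRing K] (α : K) (n r : ℕ) (hr : r < n) :
    (X : K[X]) ^ (n - 1 - r) = ∑ r' ∈ range n,
      C (((n - 1 - r).choose (n - 1 - r') : K) * α ^ (r' - r)) * (X - C α) ^ (n - 1 - r') := by
  have h : (X : K[X]) = (X - C α) + C α := by ring
  conv_lhs => rw [h, add_pow]
  rw [← Finset.sum_range_reflect (n := n)]
  have hs : range (n - 1 - r + 1) ⊆ range n := by
    intro x hx; simp at hx ⊢; omega
  rw [← Finset.sum_subset hs]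
  · apply Finset.sum_congr rfl
    intro x hx
    simp at hx
    have a1 : n - 1 - (n - 1 - x) = x := by omega
    have a2 : n - 1 - x - r = n - 1 - r - x := by omega
    rw [a1, a2]
    simp; ring
  · intro x hx hx'
    simp at hx hx'
    have a1 : n - 1 - (n - 1 - x) = x := by omega
    rw [a1, Nat.choose_eq_zero_of_lt (by omega)]
    simp

lemma Sres_one_eq {K : Type*} [CommRing K] (f g : K[X]) (s m : ℕ) :
    Sres f g (m + 2) (s + 1) 1 =
      matN (s + m) (fun r => if r < s then X ^ (s - 1 - r) * f else X ^ (m + 1 - 1 - (r - s)) * g) := by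
  unfold Sres matN
  have hN : m + 2 + (s + 1) - 2 * 1 = s + m + 1 := by omega
  refine (det_cast_nat hN (fun r c => if r < s + 1 - 1 then
      if c = m + 2 + (s + 1) - 2 * 1 - 1 then X ^ (s + 1 - 1 - 1 - r) * f
      else if c ≤ m + 2 + r then Polynomial.C (f.coeff (m + 2 + r - c))
      else 0
    else
      if c = m + 2 + (s + 1) - 2 * 1 - 1 then X ^ (m + 2 - 1 - 1 - (r - (s + 1 - 1))) * g
      else if c ≤ s + 1 + (r - (s + 1 - 1)) then
        Polynomial.C (g.coeff (s + 1 + (r - (s + 1 - 1)) - c))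
      else 0)).trans ?_
  congr 1
  ext1 r c
  have hr := r.2
  have hc := c.2
  generalize (r:ℕ) = r' at *
  simp only [Matrix.of_apply]
  have e1 : m + 2 + (s + 1) - 2 * 1 - 1 = s + m := by omega
  have e2 : m + 2 - 1 - 1 = m + 1 - 1 := by omega
  simp only [e1, e2, Nat.add_sub_cancel]
  by_cases h : (r:ℕ) < s
  · simp only [h, if_true]
    by_cases h2 : (c:ℕ) = s + m
    · simp [h2]
    · simp only [h2, if_false, coeff_X_pow_mul']
      by_cases h3 : (c:ℕ) ≤ m + 2 + r
      · rw [if_pos h3, if_pos (by omega)]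
        congr 2; omega
      · rw [if_neg h3, if_neg (by omega), C_0]
  · simp only [h, if_false]
    by_cases h2 : (c:ℕ) = s + m
    · simp [h2]
    · simp only [h2, if_false, coeff_X_pow_mul']
      by_cases h3 : (c:ℕ) ≤ s + 1 + (r - s)
      · rw [if_pos h3, if_pos (by omega)]
        congr 2; omega
      · rw [if_neg h3, if_neg (by omega), C_0]

lemma matN_shift {K : Type*} [CommRing K] (f g : K[X]) (s m : ℕ) (α : K) :
    matN (s + m) (fun r => if r < s then X ^ (s - 1 - r) * f else X ^ (m + 1 - 1 - (r - s)) * g) =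
    matN (s + m) (fun r => if r < s then (X - C α) ^ (s - 1 - r) * f
      else (X - C α) ^ (m + 1 - 1 - (r - s)) * g) := by
  apply matN_row (l := fun r r' => if r < s ∧ r' < s then
      (((s - 1 - r).choose (s - 1 - r') : K) * α ^ (r' - r))
    else if s ≤ r ∧ s ≤ r' ∧ r < s + (m + 1) ∧ r' < s + (m + 1) then
      (((m + 1 - 1 - (r - s)).choose (m + 1 - 1 - (r' - s)) : K) * α ^ ((r' - s) - (r - s)))
    else if r = r' then 1 else 0)
  · intro r r' h
    split_ifs with h1 h2 h3
    · rw [Nat.choose_eq_zero_of_lt (by omega)]; simp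
    · rw [Nat.choose_eq_zero_of_lt (by omega)]; simp
    · omega
    · rfl
  · intro r
    split_ifs <;> first | rfl | simp | omega
  · intro r hr
    rw [show s + m + 1 = s + (m + 1) by ring, Finset.sum_range_add]
    by_cases h : r < s
    · rw [if_pos h, X_pow_expand α s r h, Finset.sum_mul, Finset.sum_eq_zero (s := range (m+1)), add_zero]
      · apply Finset.sum_congr rfl
        intro x hx
        have : x < s := by simpa using hx
        simp [h, this]; ring
      · intro x hx
        rw [if_neg (by omega), if_neg (by omega), if_neg (by omega)]
        simp
    · rw [if_neg h, X_pow_expand α (m+1) (r-s) (by omega), Finset.sum_mul,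
        Finset.sum_eq_zero (s := range s), zero_add]
      · apply Finset.sum_congr rfl
        intro x hx
        have hx : x < m + 1 := by simpa using hx
        rw [if_neg (by omega), if_pos (by omega), if_neg (by omega)]
        simp; ring
      · intro x hx
        have hx : x < s := by simpa using hx
        rw [if_neg (by omega), if_neg (by omega), if_neg (by omega)]
        simp

lemma Sres_toeplitz {K : Type*} [Field K] (g : K[X]) (s m : ℕ) (α : K) (hg : g.natDegree ≤ s + 1) :
    Sres ((X - C α) ^ (m + 2)) g (m + 2) (s + 1) 1 =
    Matrix.det (Matrix.of fun r c : Fin (m+1) =>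
      if (c:ℕ) = m then (if m ≤ 1 + (r:ℕ) then C ((taylor α g).coeff (1 + r - m)) else 0) * (X - C α)
          + (if m ≤ (r:ℕ) then C ((taylor α g).coeff (r - m)) else 0)
      else if (c:ℕ) ≤ 1 + r then C ((taylor α g).coeff (1 + r - c)) else 0) := by
  have hdeg : ∀ j : ℕ, ((X - C α) ^ j).natDegree = j := fun j => by
    rw [(monic_X_sub_C α).natDegree_pow, natDegree_X_sub_C, mul_one]
  rw [Sres_one_eq, matN_shift _ _ _ _ α, matN_col _ _ α]
  swap
  · intro r hr
    split_ifs
    · rw [← pow_add, hdeg]; omega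
    · have := natDegree_mul_le (p := (X - C α) ^ (m + 1 - 1 - (r - s))) (q := g)
      rw [hdeg] at this
      omega
  have ht : ∀ (k : ℕ) (p : K[X]), taylor α ((X - C α) ^ k * p) = X ^ k * taylor α p := by
    intro k p
    rw [taylor_mul, taylor_pow]; simp
  have ht' : ∀ k : ℕ, taylor α ((X - C α) ^ k) = X ^ k := by
    intro k
    rw [taylor_pow]; simp
  rw [← Matrix.det_submatrix_equiv_self (finSumFinEquiv (m := s) (n := m+1))]
  set D := (Matrix.of fun r c : Fin (m+1) =>
      if (c:ℕ) = m then (if m ≤ 1 + (r:ℕ) then C ((taylor α g).coeff (1 + r - m)) else 0) * (X - C α)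
          + (if m ≤ (r:ℕ) then C ((taylor α g).coeff (r - m)) else 0)
      else if (c:ℕ) ≤ 1 + r then C ((taylor α g).coeff (1 + r - c)) else 0) with hD
  set B := (Matrix.of fun r c : Fin (s + m + 1) =>
      if (c : ℕ) = s + m then C ((taylor α (if (r:ℕ) < s then (X - C α) ^ (s - 1 - (r:ℕ)) * (X - C α) ^ (m + 2)
      else (X - C α) ^ (m + 1 - 1 - ((r:ℕ) - s)) * g)).coeff 1) * (X - C α) + C ((taylor α (if (r:ℕ) < s then (X - C α) ^ (s - 1 - (r:ℕ)) * (X - C α) ^ (m + 2)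
      else (X - C α) ^ (m + 1 - 1 - ((r:ℕ) - s)) * g)).coeff 0)
      else C ((taylor α (if (r:ℕ) < s then (X - C α) ^ (s - 1 - (r:ℕ)) * (X - C α) ^ (m + 2)
      else (X - C α) ^ (m + 1 - 1 - ((r:ℕ) - s)) * g)).coeff (s + m + 1 - c))) with hB
  have hblk : B.submatrix (finSumFinEquiv (m := s) (n := m+1)) (finSumFinEquiv (m := s) (n := m+1))
     = Matrix.fromBlocks 1 0 (B.submatrix (finSumFinEquiv (m := s) (n := m+1)) (finSumFinEquiv (m := s) (n := m+1))).toBlocks₂₁ D := by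
    ext1 i j
    rcases i with i | i <;> rcases j with j | j
    · simp only [Matrix.submatrix_apply, finSumFinEquiv_apply_left, Matrix.fromBlocks_apply₁₁, hB, Matrix.of_apply, Fin.val_castAdd]
      rw [if_neg (by omega), if_pos i.2, ← pow_add, ht', coeff_X_pow, Matrix.one_apply]
      by_cases h : i = j
      · subst h
        rw [if_pos (by omega), if_pos rfl, C_1]
      · have : (i:ℕ) ≠ j := fun h' => h (Fin.ext h')
        rw [if_neg (by omega), if_neg h, C_0]
    · simp only [Matrix.submatrix_apply, finSumFinEquiv_apply_left, finSumFinEquiv_apply_right, Matrix.fromBlocks_apply₁₂, hB, Matrix.of_apply, Fin.val_castAdd, Fin.val_natAdd, Matrix.zero_apply]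
      rw [if_pos i.2, ← pow_add, ht']
      simp only [coeff_X_pow]
      split_ifs <;> first | omega | contradiction | simp
    · rfl
    · simp only [Matrix.submatrix_apply, finSumFinEquiv_apply_right, Matrix.fromBlocks_apply₂₂, hB, hD, Matrix.of_apply, Fin.val_natAdd]
      rw [if_neg (by omega : ¬ s + (i:ℕ) < s), ht]
      simp only [coeff_X_pow_mul']
      by_cases hj : (j:ℕ) = m
      · rw [if_pos (by omega), if_pos hj]
        congr 1
        · congr 1
          by_cases h : m ≤ 1 + (i:ℕ)
          · rw [if_pos (by omega), if_pos h]; congr 2; omega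
          · rw [if_neg (by omega), if_neg h, C_0]
        · by_cases h : m ≤ (i:ℕ)
          · rw [if_pos (by omega), if_pos h]; congr 2; omega
          · rw [if_neg (by omega), if_neg h, C_0]
      · rw [if_neg (by omega), if_neg hj]
        by_cases h : (j:ℕ) ≤ 1 + (i:ℕ)
        · rw [if_pos (by omega), if_pos h]; congr 2; omega
        · rw [if_neg (by omega), if_neg h, C_0]
  exact (congrArg Matrix.det hblk).trans (by rw [Matrix.det_fromBlocks_zero₁₂, Matrix.det_one, one_mul])

/-- For `f̄ = (x-α)^d` (`d ≥ 2`) and `ḡ = ∏ (x-β_ℓ)^{e_ℓ}` of degree `e ≥ d`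
with all `β_ℓ ≠ α`:
`Sres₁((x-α)^d, ḡ) = ḡ(α)^{d-1} ( (∑_{∑k=d-1} ∏ binom/(α-β)^k)(x-α) + ∑_{∑k=d-2} ∏ binom/(α-β)^k )`. -/
theorem sres_one_power {K : Type*} [Field K] [CharZero K] {n : ℕ}
    (α : K) (β : Fin n → K) (hβ : ∀ ℓ, β ℓ ≠ α)
    (ee : Fin n → ℕ) (hee : ∀ ℓ, 1 ≤ ee ℓ)
    (d e : ℕ) (hd : 2 ≤ d) (he : e = ∑ ℓ, ee ℓ) (hde : d ≤ e) :
    Sres ((X - Polynomial.C α) ^ d) (∏ ℓ, (X - Polynomial.C (β ℓ)) ^ (ee ℓ)) d e 1 =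
      Polynomial.C ((Polynomial.eval α (∏ ℓ, (X - Polynomial.C (β ℓ)) ^ (ee ℓ))) ^ (d - 1)) *
        (Polynomial.C (∑ κ ∈ sumTuples n (d - 1), ∏ ℓ,
              ((ee ℓ - 1 + κ ℓ).choose (κ ℓ) : K) / (α - β ℓ) ^ (κ ℓ)) *
            (X - Polynomial.C α) +
          Polynomial.C (∑ κ ∈ sumTuples n (d - 2), ∏ ℓ,
            ((ee ℓ - 1 + κ ℓ).choose (κ ℓ) : K) / (α - β ℓ) ^ (κ ℓ))) := by
  obtain ⟨m, rfl⟩ : ∃ m, d = m + 2 := ⟨d - 2, by omega⟩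
  obtain ⟨s, rfl⟩ : ∃ s, e = s + 1 := ⟨e - 1, by omega⟩
  set g : K[X] := ∏ ℓ, (X - Polynomial.C (β ℓ)) ^ (ee ℓ) with hg
  have hb : ∀ ℓ, α - β ℓ ≠ 0 := fun ℓ => sub_ne_zero.mpr (hβ ℓ).symm
  have hgd : g.natDegree ≤ s + 1 := by
    rw [he, hg]
    refine (natDegree_prod_le _ _).trans (Finset.sum_le_sum fun ℓ _ => ?_)
    rw [(monic_X_sub_C _).natDegree_pow, natDegree_X_sub_C, mul_one]
  have htg : taylor α g = ∏ ℓ, (X + C (α - β ℓ)) ^ ee ℓ := by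
    rw [hg, ← taylorAlgHom_apply, map_prod]
    simp only [taylorAlgHom_apply]
    refine Finset.prod_congr rfl fun ℓ _ => ?_
    rw [taylor_pow]
    congr 1
    simp; ring
  have hc0 : (taylor α g).coeff 0 = g.eval α := taylor_coeff_zero α g
  have hg0 : g.eval α ≠ 0 := by
    rw [hg, eval_prod, Finset.prod_ne_zero_iff]
    intro ℓ _
    simpa using fun h => absurd h (hb ℓ)
  set S : ℕ → K := fun c => ∑ κ ∈ sumTuples n c, ∏ ℓ,
    ((ee ℓ - 1 + κ ℓ).choose (κ ℓ) : K) / (α - β ℓ) ^ (κ ℓ) with hS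
  have hconv := conv_inv (fun ℓ => α - β ℓ) hb ee hee
  rw [← htg] at hconv
  rw [Sres_toeplitz g s m α hgd]
  rw [toeplitz_det m (fun j => C ((taylor α g).coeff j)) (fun c => C ((-1) ^ c * S c)) (X - C α)]
  · change _ = C (g.eval α ^ (m + 1)) * (C (S (m + 1)) * (X - C α) + C (S m))
    have hs : ∀ k : ℕ, (-1 : K[X]) ^ k * C ((-1) ^ k * S k) = C (S k) := by
      intro k
      rw [C_mul, ← mul_assoc, C_pow, ← mul_pow]; simp
    simp only [hs, hc0, C_pow]
  · simp only [hc0]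
    simpa using hg0
  · intro i
    have h := congrArg (C : K →+* K[X]) (hconv i)
    rw [map_sum] at h
    simp only [C_mul] at h ⊢
    rw [h]
    split_ifs <;> simp
end

section
/- Let $\overline{A}=((\alpha_1,d_1);\ldots;(\alpha_m,d_m))$, $\overline{B}=((\beta_1,e_1);\ldots;(\beta_n,e_n))$ and $\overline{A}\cup\overline{B}$ their concatenation. Then $\det V(\overline{A}\cup\overline{B})=\det V(\overline{A})\,\det V(\overline{B})\,\prod_{i,j}(\beta_j-\alpha_i)^{d_i e_j}$. -/
open Finset

/-- Entry helper for the confluent Vandermonde matrix: `binom(k,j) * a^(k-j)`,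
with the convention that it is `0` when `k < j`. -/
def dcoef {K : Type*} [CommRing K] (k j : ℕ) (a : K) : K :=
  if j ≤ k then (k.choose j : K) * a ^ (k - j) else 0

/-- The position in `Fin (∑ i, d i)` of the `j`-th column of the `i`-th block. -/
def sigmaToFin {m : ℕ} (d : Fin m → ℕ) (p : Σ i, Fin (d i)) : Fin (∑ i, d i) :=
  ⟨∑ i ∈ Finset.univ.filter (fun i => i < p.1), d i + (p.2 : ℕ), by
    have h1 : (p.2 : ℕ) < d p.1 := p.2.isLt
    have h2 : d p.1 + ∑ i ∈ Finset.univ.filter (fun i => i < p.1), d i ≤ ∑ i, d i := by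
      rw [← Finset.sum_insert (by simp)]
      exact Finset.sum_le_sum_of_subset (Finset.subset_univ _)
    omega⟩

/-- The square confluent (generalized Vandermonde) matrix of points `α i` with
multiplicities `d i`. -/
def confVdm {K : Type*} [CommRing K] {m : ℕ} (α : Fin m → K) (d : Fin m → ℕ) :
    Matrix (Fin (∑ i, d i)) (Fin (∑ i, d i)) K :=
  Matrix.of fun k c =>
    ∑ p : Σ i, Fin (d i),
      if (sigmaToFin d p : ℕ) = (c : ℕ) then dcoef (k : ℕ) (p.2 : ℕ) (α p.1) else 0

theorem sigmaToFin_eq {m : ℕ} (d : Fin m → ℕ) (p : Σ i, Fin (d i)) :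
    sigmaToFin d p = finSigmaFinEquiv p := by
  apply Fin.ext
  rw [finSigmaFinEquiv_apply]
  simp only [sigmaToFin]
  congr 1
  obtain ⟨i, j⟩ := p
  symm
  refine Finset.sum_bij (fun a _ => Fin.castLE i.2.le a) ?_ ?_ ?_ ?_
  · intro a _
    simp only [mem_filter, mem_univ, true_and, Fin.lt_def]
    exact a.2
  · intro a _ b _ h
    simpa [Fin.ext_iff] using h
  · intro b hb
    simp only [mem_filter, mem_univ, true_and, Fin.lt_def] at hb
    exact ⟨⟨b, hb⟩, mem_univ _, rfl⟩
  · intro a _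
    rfl

theorem sigmaToFin_append_left {m n : ℕ} (d : Fin m → ℕ) (e : Fin n → ℕ) (i : Fin m)
    (j : Fin (d i)) (j' : Fin (Fin.append d e (Fin.castAdd n i))) (h : (j' : ℕ) = j) :
    (sigmaToFin (Fin.append d e) ⟨Fin.castAdd n i, j'⟩ : ℕ) = sigmaToFin d ⟨i, j⟩ := by
  simp only [sigmaToFin, h, sum_filter, Fin.sum_univ_add, Fin.append_left, Fin.append_right]
  have h1 : ∀ x : Fin n, ¬ (Fin.natAdd m x < Fin.castAdd n i) := by
    intro x
    simp only [Fin.lt_def, Fin.val_natAdd, Fin.val_castAdd]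
    omega
  simp only [h1, Fin.lt_def, Fin.val_castAdd, if_false, sum_const_zero, add_zero]

theorem sigmaToFin_append_right {m n : ℕ} (d : Fin m → ℕ) (e : Fin n → ℕ) (i : Fin n)
    (j : Fin (e i)) (j' : Fin (Fin.append d e (Fin.natAdd m i))) (h : (j' : ℕ) = j) :
    (sigmaToFin (Fin.append d e) ⟨Fin.natAdd m i, j'⟩ : ℕ) =
      (∑ i, d i) + sigmaToFin e ⟨i, j⟩ := by
  simp only [sigmaToFin, h, sum_filter, Fin.sum_univ_add, Fin.append_left, Fin.append_right]
  have h1 : ∀ x : Fin m, (Fin.castAdd n x < Fin.natAdd m i) := by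
    intro x
    simp only [Fin.lt_def, Fin.val_natAdd, Fin.val_castAdd]
    omega
  simp only [h1, Fin.lt_def, Fin.val_natAdd, if_true, add_assoc, Nat.add_lt_add_iff_left]

open Polynomial in
/-- evaluation of a Hasse derivative as a linear functional -/
noncomputable def hfun {K : Type*} [CommRing K] (a : K) (j : ℕ) : K[X] →ₗ[K] K :=
  (Polynomial.lcoeff K j).comp (Polynomial.taylor a : K[X] →ₗ[K] K[X])

open Polynomial in
theorem hfun_apply {K : Type*} [CommRing K] (a : K) (j : ℕ) (q : K[X]) :
    hfun a j q = (taylor a q).coeff j := rfl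

open Polynomial in
theorem hfun_X_pow {K : Type*} [CommRing K] (a : K) (k j : ℕ) :
    hfun a j (X ^ k) = dcoef k j a := by
  rw [hfun_apply, taylor_X_pow, coeff_X_add_C_pow, dcoef]
  split_ifs with h
  · ring
  · rw [Nat.choose_eq_zero_of_lt (by omega)]; simp

theorem confVdm_apply {K : Type*} [CommRing K] {m : ℕ} (α : Fin m → K) (d : Fin m → ℕ)
    (k : Fin (∑ i, d i)) (c : Fin (∑ i, d i)) (p : Σ i, Fin (d i))
    (h : (sigmaToFin d p : ℕ) = c) :
    confVdm α d k c = hfun (α p.1) p.2 (Polynomial.X ^ (k : ℕ)) := by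
  rw [hfun_X_pow]
  simp only [confVdm, Matrix.of_apply]
  rw [Finset.sum_eq_single p]
  · simp [h]
  · intro b _ hb
    rw [if_neg]
    intro h2
    apply hb
    rw [← h] at h2
    have h3 := Fin.ext h2
    rw [sigmaToFin_eq, sigmaToFin_eq] at h3
    exact finSigmaFinEquiv.injective h3
  · simp

open Polynomial in
theorem hfun_eq_sum {K : Type*} [CommRing K] (a : K) (j : ℕ) (q : K[X]) (N : ℕ)
    (hq : q.natDegree < N) :
    hfun a j q = ∑ k ∈ range N, q.coeff k * hfun a j (X ^ k) := by
  conv_lhs => rw [q.as_sum_range_C_mul_X_pow' hq]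
  rw [map_sum]
  refine sum_congr rfl fun k _ => ?_
  rw [← smul_eq_C_mul, map_smul, smul_eq_mul]

open Polynomial in
theorem hfun_mul {K : Type*} [CommRing K] (a : K) (j : ℕ) (p q : K[X]) :
    hfun a j (p * q) = ∑ l ∈ range (j + 1), hfun a l p * hfun a (j - l) q := by
  simp only [hfun_apply, taylor_mul, coeff_mul]
  rw [Finset.Nat.sum_antidiagonal_eq_sum_range_succ_mk]

open Polynomial in
theorem hfun_zero_of_dvd {K : Type*} [CommRing K] (a : K) (j e : ℕ) (p : K[X])
    (h : (X - C a) ^ e ∣ p) (hj : j < e) : hfun a j p = 0 := by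
  obtain ⟨q, rfl⟩ := h
  rw [hfun_apply, taylor_mul, taylor_pow]
  have : taylor a (X - C a) = X := by simp
  rw [this, coeff_X_pow_mul', if_neg (by omega)]

theorem det_blockDiag_aux {K : Type*} [CommRing K] {n : ℕ} (e : Fin n → ℕ)
    (T : ∀ i, Matrix (Fin (e i)) (Fin (e i)) K) :
    (Matrix.blockDiagonal' T).det = ∏ i, (T i).det := by
  rw [(Matrix.blockTriangular_blockDiagonal' T).det_fintype]
  refine Finset.prod_congr rfl fun i _ => ?_
  let E : Fin (e i) ≃ {a : Σ i, Fin (e i) // a.1 = i} :=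
    { toFun := fun j => ⟨⟨i, j⟩, rfl⟩
      invFun := fun a => Fin.cast (by rw [a.2]) a.1.2
      left_inv := fun j => rfl
      right_inv := by
        rintro ⟨⟨i', j⟩, h⟩
        dsimp only at h
        subst h
        rfl }
  rw [← Matrix.det_submatrix_equiv_self E]
  congr 1
  ext a b
  exact Matrix.blockDiagonal'_apply_eq T i a b

/-- multiplying all functionals by `P` -/
theorem det_mulP {K : Type*} [CommRing K] {n : ℕ} (β : Fin n → K) (e : Fin n → ℕ)
    (P : Polynomial K) (W : Matrix (Fin (∑ i, e i)) (Fin (∑ i, e i)) K)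
    (hW : ∀ k p, W k (sigmaToFin e p) = hfun (β p.1) p.2 (Polynomial.X ^ (k : ℕ) * P)) :
    W.det = (confVdm β e).det * ∏ i, (P.eval (β i)) ^ (e i) := by
  classical
  let T : ∀ i, Matrix (Fin (e i)) (Fin (e i)) K := fun i => Matrix.of fun l j =>
    if (l : ℕ) ≤ j then hfun (β i) ((j : ℕ) - l) P else 0
  have hT : ∀ i, (T i).det = (P.eval (β i)) ^ (e i) := by
    intro i
    rw [Matrix.det_of_isUpperTriangular]
    · simp [T, hfun_apply, Polynomial.taylor_coeff_zero]
    · intro a b hab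
      have : ¬ ((a : ℕ) ≤ b) := by
        have : b < a := hab
        simpa using this
      simp only [T, Matrix.of_apply]
      rw [if_neg this]
  have key : W.submatrix finSigmaFinEquiv finSigmaFinEquiv =
      (confVdm β e).submatrix finSigmaFinEquiv finSigmaFinEquiv * Matrix.blockDiagonal' T := by
    ext r ⟨i, j⟩
    rw [Matrix.mul_apply, Fintype.sum_sigma]
    refine Eq.trans ?_ (Finset.sum_eq_single i ?_ ?_).symm
    · rw [Matrix.submatrix_apply, ← sigmaToFin_eq e ⟨i, j⟩, hW, hfun_mul]
      simp only [Matrix.submatrix_apply, Matrix.blockDiagonal'_apply_eq]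
      have : ∀ x : Fin (e i), confVdm β e (finSigmaFinEquiv r) (finSigmaFinEquiv ⟨i, x⟩) * T i x j
          = (fun l : ℕ => if l ≤ (j : ℕ) then
            hfun (β i) l (Polynomial.X ^ (finSigmaFinEquiv r : ℕ)) * hfun (β i) ((j : ℕ) - l) P
            else 0) x := by
        intro x
        rw [confVdm_apply β e _ _ ⟨i, x⟩ (by rw [sigmaToFin_eq])]
        simp [T]
      rw [Finset.sum_congr rfl (fun x _ => this x), Fin.sum_univ_eq_sum_range
        (fun l : ℕ => if l ≤ (j : ℕ) then
            hfun (β i) l (Polynomial.X ^ (finSigmaFinEquiv r : ℕ)) * hfun (β i) ((j : ℕ) - l) P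
            else 0) (e i), ← Finset.sum_filter]
      refine Finset.sum_congr ?_ fun _ _ => rfl
      ext l
      have := j.2
      simp only [mem_range, mem_filter]
      omega
    · intro i' _ hi'
      refine Finset.sum_eq_zero fun x _ => ?_
      rw [Matrix.blockDiagonal'_apply_ne _ _ _ hi', mul_zero]
    · simp
  rw [← Matrix.det_submatrix_equiv_self finSigmaFinEquiv W, key, Matrix.det_mul,
    Matrix.det_submatrix_equiv_self, det_blockDiag_aux]
  simp [hT]

/-- `det V(Ā ∪ B̄) = det V(Ā) det V(B̄) ∏_{i,j} (βⱼ - αᵢ)^{dᵢeⱼ}`, where `Ā ∪ B̄` is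
the concatenation of the two weighted point configurations. -/
theorem det_confVdm_append {K : Type*} [CommRing K] {m n : ℕ}
    (α : Fin m → K) (β : Fin n → K) (dd : Fin m → ℕ) (ee : Fin n → ℕ) :
    (confVdm (Fin.append α β) (Fin.append dd ee)).det =
      (confVdm α dd).det * (confVdm β ee).det *
        ∏ i, ∏ j, (β j - α i) ^ (dd i * ee j) := by
  classical
  nontriviality K
  have hN : (∑ i, dd i) + (∑ i, ee i) = ∑ i, Fin.append dd ee i := by
    simp [Fin.sum_univ_add]
  let E : Fin (∑ i, dd i) ⊕ Fin (∑ i, ee i) ≃ Fin (∑ i, Fin.append dd ee i) :=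
    finSumFinEquiv.trans (finCongr hN)
  have hEl : ∀ c, (E (Sum.inl c) : ℕ) = c := fun c => by simp [E]
  have hEr : ∀ c, (E (Sum.inr c) : ℕ) = (∑ i, dd i) + c := fun c => by simp [E]
  let P : Polynomial K := ∏ i, (Polynomial.X - Polynomial.C (α i)) ^ (dd i)
  have hPm : P.Monic := Polynomial.monic_prod_of_monic _ _ fun i _ =>
    (Polynomial.monic_X_sub_C _).pow _
  have hPd : P.natDegree = ∑ i, dd i := by
    rw [Polynomial.natDegree_prod_of_monic _ _ fun i _ => (Polynomial.monic_X_sub_C _).pow _]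
    refine Finset.sum_congr rfl fun i _ => ?_
    rw [(Polynomial.monic_X_sub_C _).natDegree_pow]
    simp
  let R : Fin (∑ i, dd i) ⊕ Fin (∑ i, ee i) → Polynomial K :=
    Sum.elim (fun k => Polynomial.X ^ (k : ℕ)) (fun k => Polynomial.X ^ (k : ℕ) * P)
  have hXm : ∀ k : ℕ, (Polynomial.X ^ k * P).Monic := fun k => (Polynomial.monic_X_pow k).mul hPm
  have hXd : ∀ k : ℕ, (Polynomial.X ^ k * P).natDegree = k + ∑ i, dd i := fun k => by
    rw [(Polynomial.monic_X_pow k).natDegree_mul hPm, hPd, Polynomial.natDegree_X_pow]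
  have hR : ∀ r, (R r).natDegree < ∑ i, Fin.append dd ee i := by
    rintro (k | k)
    · simp only [R, Sum.elim_inl, Polynomial.natDegree_X_pow]
      omega
    · simp only [R, Sum.elim_inr, hXd]
      omega
  let M := confVdm (Fin.append α β) (Fin.append dd ee)
  let U : Matrix (Fin (∑ i, dd i) ⊕ Fin (∑ i, ee i)) (Fin (∑ i, dd i) ⊕ Fin (∑ i, ee i)) K :=
    Matrix.of fun r s => (R r).coeff (E s : ℕ)
  have hU : U.det = 1 := by
    rw [← Matrix.fromBlocks_toBlocks U]
    have h12 : U.toBlocks₁₂ = 0 := by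
      ext k s
      simp only [Matrix.toBlocks₁₂, U, R, Matrix.of_apply, Sum.elim_inl, hEr,
        Polynomial.coeff_X_pow, Matrix.zero_apply]
      rw [if_neg (by omega)]
    have h11 : U.toBlocks₁₁ = 1 := by
      ext k s
      simp only [Matrix.toBlocks₁₁, U, R, Matrix.of_apply, Sum.elim_inl, hEl,
        Polynomial.coeff_X_pow, Matrix.one_apply, Fin.ext_iff]
      simp only [eq_comm]
    rw [h12, h11, Matrix.det_fromBlocks_zero₁₂, Matrix.det_one, one_mul,
      Matrix.det_of_isLowerTriangular]
    · refine Finset.prod_eq_one fun k _ => ?_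
      simp only [Matrix.toBlocks₂₂, U, R, Matrix.of_apply, Sum.elim_inr, hEr]
      rw [add_comm, ← hXd]
      exact hXm k
    · intro a b hab
      have hab' : (a : ℕ) < b := by
        have : a < b := hab
        exact this
      simp only [Matrix.toBlocks₂₂, U, R, Matrix.of_apply, Sum.elim_inr, hEr]
      apply Polynomial.coeff_eq_zero_of_natDegree_lt
      rw [hXd]
      omega
  have hUM : ∀ r c p, (sigmaToFin (Fin.append dd ee) p : ℕ) = E c →
      (U * M.submatrix E E) r c = hfun (Fin.append α β p.1) p.2 (R r) := by
    intro r c p hp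
    rw [hfun_eq_sum _ _ _ _ (hR r), Matrix.mul_apply, ← Fin.sum_univ_eq_sum_range
      (fun k => (R r).coeff k * hfun (Fin.append α β p.1) p.2 (Polynomial.X ^ k)),
      ← Equiv.sum_comp E]
    refine Finset.sum_congr rfl fun s _ => ?_
    have h := confVdm_apply (Fin.append α β) (Fin.append dd ee) (E s) (E c) p hp
    exact congrArg (fun z => (R r).coeff (E s : ℕ) * z) h
  have hL : ∀ r p, (U * M.submatrix E E) r (Sum.inl (sigmaToFin dd p)) =
      hfun (α p.1) p.2 (R r) := by
    rintro r ⟨i, j⟩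
    rw [hUM r _ ⟨Fin.castAdd n i, Fin.cast (by simp) j⟩]
    · simp
    · rw [hEl]
      exact sigmaToFin_append_left _ _ _ _ _ (by simp)
  have hRt : ∀ r p, (U * M.submatrix E E) r (Sum.inr (sigmaToFin ee p)) =
      hfun (β p.1) p.2 (R r) := by
    rintro r ⟨i, j⟩
    rw [hUM r _ ⟨Fin.natAdd m i, Fin.cast (by simp) j⟩]
    · simp
    · rw [hEr]
      exact sigmaToFin_append_right _ _ _ _ _ (by simp)
  have hsurj : ∀ c, ∃ p, sigmaToFin dd p = c := fun c =>
    ⟨finSigmaFinEquiv.symm c, by rw [sigmaToFin_eq]; simp⟩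
  have hdet : M.det = (U * M.submatrix E E).det := by
    rw [Matrix.det_mul, hU, one_mul, Matrix.det_submatrix_equiv_self]
  change M.det = _
  rw [hdet, ← Matrix.fromBlocks_toBlocks (U * M.submatrix E E)]
  have h21 : (U * M.submatrix E E).toBlocks₂₁ = 0 := by
    ext k c
    obtain ⟨p, rfl⟩ := hsurj c
    simp only [Matrix.toBlocks₂₁, Matrix.of_apply, hL, Matrix.zero_apply]
    refine hfun_zero_of_dvd _ _ (dd p.1) _ ?_ p.2.2
    simp only [R, Sum.elim_inr]
    exact Dvd.dvd.mul_left (Finset.dvd_prod_of_mem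
      (fun i => (Polynomial.X - Polynomial.C (α i)) ^ (dd i)) (mem_univ p.1)) _
  have h11 : (U * M.submatrix E E).toBlocks₁₁ = confVdm α dd := by
    ext k c
    obtain ⟨p, rfl⟩ := hsurj c
    simp only [Matrix.toBlocks₁₁, Matrix.of_apply, hL]
    rw [confVdm_apply α dd _ _ p rfl]
    rfl
  rw [h21, h11, Matrix.det_fromBlocks_zero₂₁, det_mulP β ee P, mul_assoc]
  · congr 2
    rw [Finset.prod_comm]
    refine Finset.prod_congr rfl fun j _ => ?_
    simp only [P, Polynomial.eval_prod, Polynomial.eval_pow, Polynomial.eval_sub,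
      Polynomial.eval_X, Polynomial.eval_C, ← Finset.prod_pow, ← pow_mul]
  · intro k p
    simp only [Matrix.toBlocks₂₂, Matrix.of_apply, hRt]
    rfl
end

section
/- Let $\overline{f},\overline{g}$ be monic of degrees $d,e$ with root structures $\overline{A},\overline{B}$ (pairwise distinct $\alpha_i$, pairwise distinct $\beta_j$). For $0\le t\le d<e$ or $0\le t<d=e$: $\det V(\overline{A})\cdot\mathrm{Sres}_t(\overline{f},\overline{g})=(-1)^{d-t}\det M$, where $M$ is the $(d+1)\times(d+1)$ matrix whose first $t+1$ rows are $[V_{t+1}(\overline{A})\mid (1,x,\ldots,x^t)^T]$ and whose last $d-t$ rows are $[W_{\overline{g},d-t}(\overline{A})\mid 0]$. -/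
open Finset Polynomial

lemma sres_eq_rem {K : Type*} [Field K] (f g : K[X]) (d e t : ℕ) (hf : f.Monic)
    (hfd : f.natDegree = d) (hge : g.natDegree ≤ e) (htd : t < d) (hde : d ≤ e) :
    Sres f g d e t = Matrix.det (Matrix.of fun i c : Fin (d - t) =>
      if (c : ℕ) = d - t - 1 then (X ^ (d - t - 1 - (i : ℕ)) * g) %ₘ f
      else C (((X ^ (d - t - 1 - (i : ℕ)) * g) %ₘ f).coeff (d - 1 - (c : ℕ)))) := by
  have hsz : (e - t) + (d - t) = d + e - 2 * t := by omega
  let E : Fin (e - t) ⊕ Fin (d - t) ≃ Fin (d + e - 2 * t) :=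
    finSumFinEquiv.trans (finCongr hsz)
  have El : ∀ k, ((E (Sum.inl k) : Fin _) : ℕ) = k := fun k => by simp [E]
  have Er : ∀ k, ((E (Sum.inr k) : Fin _) : ℕ) = e - t + k := fun k => by simp [E]
  let φ : K[X] → ℕ → K[X] := fun p c =>
    if c = d + e - 2 * t - 1 then p else C (p.coeff (d + e - t - 1 - c))
  have φadd : ∀ p q c, φ (p + q) c = φ p c + φ q c := by
    intro p q c; simp only [φ]; split_ifs <;> simp
  have φsum : ∀ (n : ℕ) (a : Fin n → K) (p : Fin n → K[X]) c,
      φ (∑ k, C (a k) * p k) c = ∑ k, C (a k) * φ (p k) c := by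
    intro n a p c; simp only [φ]; split_ifs <;> simp [finset_sum_coeff]
  unfold Sres
  rw [← Matrix.det_submatrix_equiv_self E]
  let q : Fin (d - t) → K[X] := fun i => (X ^ (d - t - 1 - (i : ℕ)) * g) /ₘ f
  let R : Fin (d - t) → K[X] := fun i => (X ^ (d - t - 1 - (i : ℕ)) * g) %ₘ f
  have hqdeg : ∀ i, (q i).natDegree < e - t := by
    intro i
    have h1 : (X ^ (d - t - 1 - (i : ℕ)) * g).natDegree ≤ d - t - 1 - i + e :=
      natDegree_mul_le.trans (by
        have := natDegree_X_pow_le (R := K) (d - t - 1 - (i : ℕ)); omega)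
    have := natDegree_divByMonic (X ^ (d - t - 1 - (i : ℕ)) * g) hf
    simp only [q]; rw [this]; omega
  have hRdeg : ∀ i k, d ≤ k → (R i).coeff k = 0 := by
    intro i k hk
    apply coeff_eq_zero_of_degree_lt
    refine (degree_modByMonic_lt _ hf).trans_le ?_
    rw [degree_eq_natDegree hf.ne_zero, hfd]; exact_mod_cast hk
  have hqf : ∀ i, q i * f = ∑ k : Fin (e - t), C ((q i).coeff (e - t - 1 - k)) *
      (X ^ (e - t - 1 - (k : ℕ)) * f) := by
    intro i
    conv_lhs => rw [(q i).as_sum_range_C_mul_X_pow' (hqdeg i), sum_mul,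
      Finset.sum_range, ← Equiv.sum_comp Fin.revPerm]
    refine Finset.sum_congr rfl fun k _ => ?_
    simp only [Fin.revPerm_apply, Fin.val_rev]
    rw [mul_assoc, show e - t - (k + 1) = e - t - 1 - (k : ℕ) by omega]
  have hR : ∀ i, R i = ∑ k : Fin (e - t), C (-(q i).coeff (e - t - 1 - k)) *
      (X ^ (e - t - 1 - (k : ℕ)) * f) + X ^ (d - t - 1 - (i : ℕ)) * g := by
    intro i
    have h := modByMonic_add_div (X ^ (d - t - 1 - (i : ℕ)) * g) f
    simp only [C_neg, neg_mul, Finset.sum_neg_distrib]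
    rw [← hqf]
    simp only [R, q]
    linear_combination h
  set S := (Matrix.of fun r c : Fin (d + e - 2 * t) =>
    if (r : ℕ) < e - t then
      if (c : ℕ) = d + e - 2 * t - 1 then X ^ (e - t - 1 - (r : ℕ)) * f
      else if (c : ℕ) ≤ d + (r : ℕ) then Polynomial.C (f.coeff (d + (r : ℕ) - (c : ℕ)))
      else 0
    else
      if (c : ℕ) = d + e - 2 * t - 1 then X ^ (d - t - 1 - ((r : ℕ) - (e - t))) * g
      else if (c : ℕ) ≤ e + ((r : ℕ) - (e - t)) then
        Polynomial.C (g.coeff (e + ((r : ℕ) - (e - t)) - (c : ℕ)))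
      else 0) with hS
  have hSl : ∀ (k : Fin (e - t)) c, S (E (Sum.inl k)) c =
      φ (X ^ (e - t - 1 - (k : ℕ)) * f) c := by
    intro k c
    have := k.2
    have := c.2
    simp only [hS, Matrix.of_apply, El, φ, if_pos k.2, coeff_X_pow_mul']
    split_ifs with h1 h2 h3 h3
    · rfl
    · congr 2; omega
    · omega
    · omega
    · simp
  have hSr : ∀ (k : Fin (d - t)) c, S (E (Sum.inr k)) c =
      φ (X ^ (d - t - 1 - (k : ℕ)) * g) c := by
    intro k c
    have := k.2
    have := c.2
    have h0 : ¬ (e - t + (k : ℕ) < e - t) := by omega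
    simp only [hS, Matrix.of_apply, Er, φ, if_neg h0, coeff_X_pow_mul', Nat.add_sub_cancel_left]
    split_ifs with h1 h2 h3 h3
    · rfl
    · congr 2; omega
    · omega
    · omega
    · simp
  let U : Matrix (Fin (e - t) ⊕ Fin (d - t)) (Fin (e - t) ⊕ Fin (d - t)) K[X] :=
    Matrix.fromBlocks 1 0 (Matrix.of fun i k => C (-(q i).coeff (e - t - 1 - k))) 1
  have hU : U.det = 1 := by simp [U]
  have hmul : U * S.submatrix E E = Matrix.fromBlocks
      (Matrix.of fun i c : Fin (e - t) => φ (X ^ (e - t - 1 - (i : ℕ)) * f) c)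
      (Matrix.of fun (i : Fin (e - t)) (c : Fin (d - t)) =>
        φ (X ^ (e - t - 1 - (i : ℕ)) * f) (e - t + c))
      0
      (Matrix.of fun i c : Fin (d - t) => φ (R i) (e - t + c)) := by
    have key : ∀ i c, (U * S.submatrix E E) (Sum.inr i) c = φ (R i) (E c) := by
      intro i c
      simp only [Matrix.mul_apply, Fintype.sum_sum_type, Matrix.submatrix_apply, hSl, hSr, U,
        Matrix.fromBlocks_apply₂₁, Matrix.fromBlocks_apply₂₂, Matrix.of_apply]
      rw [hR, φadd, φsum]
      simp [Matrix.one_apply]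
    have key2 : ∀ i c, (U * S.submatrix E E) (Sum.inl i) c =
        φ (X ^ (e - t - 1 - (i : ℕ)) * f) (E c) := by
      intro i c
      simp only [Matrix.mul_apply, Fintype.sum_sum_type, Matrix.submatrix_apply, hSl, hSr, U,
        Matrix.fromBlocks_apply₁₁, Matrix.fromBlocks_apply₁₂]
      simp [Matrix.one_apply]
    ext1 i c
    rcases i with i | i <;> rcases c with c | c
    · rw [key2, El]; rfl
    · rw [key2, Er]; rfl
    · rw [key, El]
      have := c.2
      simp only [φ, Matrix.fromBlocks_apply₂₁, Matrix.zero_apply]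
      rw [if_neg (by omega), hRdeg _ _ (by omega), C_0]
    · rw [key, Er]; rfl
  have hdet : (S.submatrix E E).det = (U * S.submatrix E E).det := by
    rw [Matrix.det_mul, hU, one_mul]
  rw [hdet, hmul, Matrix.det_fromBlocks_zero₂₁, Matrix.det_of_upperTriangular]
  · rw [Finset.prod_eq_one, one_mul]
    · congr 1
      ext1 i c
      have := c.2
      simp only [Matrix.of_apply, φ, R]
      by_cases h : (c : ℕ) = d - t - 1
      · rw [if_pos h, if_pos (by omega)]
      · rw [if_neg h, if_neg (by omega)]; congr 2; omega
    · intro i _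
      have := i.2
      simp only [Matrix.of_apply, φ]
      rw [if_neg (by omega), coeff_X_pow_mul', if_pos (by omega),
        show d + e - t - 1 - (i : ℕ) - (e - t - 1 - i) = f.natDegree by omega,
        coeff_natDegree, hf.leadingCoeff, C_1]
  · intro i c hic
    have hic' : (c : ℕ) < i := hic
    have := i.2
    simp only [Matrix.of_apply, φ]
    rw [if_neg (by omega), coeff_X_pow_mul', if_pos (by omega),
      coeff_eq_zero_of_natDegree_lt (by omega), C_0]

/-- The matrix `M` for abstract functionals `L c`. -/
noncomputable def absM {K : Type*} [Field K] (L : ℕ → K[X] →ₗ[K] K) (g : K[X]) (d t : ℕ) :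
    Matrix (Fin (d + 1)) (Fin (d + 1)) K[X] :=
  Matrix.of fun r c : Fin (d + 1) =>
    if (r : ℕ) < t + 1 then
      if (c : ℕ) < d then C (L c (X ^ (r : ℕ))) else X ^ (r : ℕ)
    else
      if (c : ℕ) < d then C (L c (X ^ ((r : ℕ) - (t + 1)) * g)) else 0

lemma det_snoc_aux {R : Type*} [CommRing R] (d : ℕ) (V : Matrix (Fin d) (Fin d) R)
    (D : Matrix (Fin (d + 1)) (Fin (d + 1)) R) (x : R)
    (h1 : ∀ i j : Fin d, D i.castSucc j.castSucc = V i j)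
    (h2 : ∀ j : Fin d, D (Fin.last d) j.castSucc = 0)
    (h3 : D (Fin.last d) (Fin.last d) = x) : D.det = V.det * x := by
  rw [Matrix.det_succ_row D (Fin.last d), Fin.sum_univ_castSucc]
  rw [Finset.sum_eq_zero (fun j _ => by rw [h2]; ring), h3]
  have : D.submatrix (Fin.last d).succAbove (Fin.last d).succAbove = V := by
    ext i j; simp [h1]
  rw [this]
  simp only [Fin.val_last, zero_add, Even.neg_one_pow ⟨d, rfl⟩]
  ring

lemma abs_top {K : Type*} [Field K] (L : ℕ → K[X] →ₗ[K] K) (f g : K[X]) (d : ℕ)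
    (hf : f.Monic) (hfd : f.natDegree = d) (hL : ∀ c q, L c (q * f) = 0) :
    (absM L g d d).det = C (Matrix.det (Matrix.of fun k c : Fin d => L c (X ^ (k : ℕ)))) * f := by
  have h := Matrix.det_updateRow_sum (absM L g d d) (Fin.last d) (fun k => C (f.coeff k))
  have h1 : C (f.coeff (Fin.last d : Fin (d+1))) = (1 : K[X]) := by
    simp [← hfd, hf.leadingCoeff]
  simp only [h1, one_smul] at h
  rw [← h, RingHom.map_det]
  have hfs : f = ∑ k : Fin (d + 1), C (f.coeff k) * X ^ (k : ℕ) := by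
    conv_lhs => rw [f.as_sum_range_C_mul_X_pow' (n := d + 1) (by omega), Finset.sum_range]
  apply det_snoc_aux
  · intro i j
    rw [Matrix.updateRow_ne (Fin.castSucc_lt_last i).ne]
    have := i.2
    simp [absM, show (i : ℕ) < d + 1 by omega]
  · intro j
    rw [Matrix.updateRow_self]
    simp only [Finset.sum_apply, Pi.smul_apply, smul_eq_mul]
    have : ∀ k : Fin (d + 1), C (f.coeff k) * absM L g d d k j.castSucc =
        C (L j (C (f.coeff k) * X ^ (k : ℕ))) := by
      intro k
      have e1 : L j (C (f.coeff k) * X ^ (k : ℕ)) = f.coeff k * L j (X ^ (k : ℕ)) := by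
        rw [← smul_eq_C_mul, map_smul, smul_eq_mul]
      have e2 : absM L g d d k j.castSucc = C (L j (X ^ (k : ℕ))) := by
        have hk := k.2
        simp only [absM, Matrix.of_apply]
        rw [if_pos hk, if_pos (by simp)]
        simp
      rw [e1, e2, C_mul]
    simp only [this]
    rw [← map_sum, ← map_sum, ← hfs]
    have := hL j 1
    rw [one_mul] at this
    rw [this, C_0]
  · rw [Matrix.updateRow_self]
    simp only [Finset.sum_apply, Pi.smul_apply, smul_eq_mul]
    conv_rhs => rw [hfs]
    refine Finset.sum_congr rfl fun k _ => ?_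
    have hk := k.2
    simp only [absM, Matrix.of_apply]
    rw [if_pos hk, if_neg (by simp)]

lemma sres_top {K : Type*} [Field K] (f g : K[X]) (d e : ℕ) (hf : f.Monic)
    (hfd : f.natDegree = d) (hde : d < e) : Sres f g d e d = f := by
  unfold Sres
  rw [Matrix.det_of_upperTriangular]
  · rw [Finset.prod_eq_single (⟨e - d - 1, by omega⟩ : Fin (d + e - 2 * d))]
    · simp only [Matrix.of_apply]
      rw [if_pos (by omega), if_pos (by omega)]
      simp
    · intro i _ hi
      have := i.2
      have hi' : (i : ℕ) ≠ e - d - 1 := fun h => hi (Fin.ext h)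
      simp only [Matrix.of_apply]
      rw [if_pos (by omega), if_neg (by omega), if_pos (by omega), Nat.add_sub_cancel, ← hfd,
        coeff_natDegree, hf.leadingCoeff, C_1]
    · simp
  · intro i c hic
    have hic' : (c : ℕ) < i := hic
    have := i.2
    simp only [Matrix.of_apply]
    rw [if_pos (by omega), if_neg (by omega), if_pos (by omega),
      coeff_eq_zero_of_natDegree_lt (by omega), C_0]

/-- The matrix after factoring out the Vandermonde part. -/
noncomputable def redM {K : Type*} [Field K] (f g : K[X]) (d t : ℕ) :
    Matrix (Fin (d + 1)) (Fin (d + 1)) K[X] :=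
  Matrix.of fun r c : Fin (d + 1) =>
    if (c : ℕ) < d then
      C ((if (r : ℕ) < t + 1 then X ^ (r : ℕ) else (X ^ ((r : ℕ) - (t + 1)) * g) %ₘ f).coeff c)
    else if (r : ℕ) < t + 1 then X ^ (r : ℕ) else 0

lemma abs_factor {K : Type*} [Field K] (L : ℕ → K[X] →ₗ[K] K) (f g : K[X]) (d t : ℕ)
    (hf : f.Monic) (hfd : f.natDegree = d) (hL : ∀ c q, L c (q * f) = 0) (htd : t < d) :
    (absM L g d t).det = C (Matrix.det (Matrix.of fun k c : Fin d => L c (X ^ (k : ℕ)))) *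
      (redM f g d t).det := by
  let D : Matrix (Fin (d + 1)) (Fin (d + 1)) K[X] := Matrix.of fun k c =>
    if (k : ℕ) < d then if (c : ℕ) < d then C (L c (X ^ (k : ℕ))) else 0
    else if (c : ℕ) < d then 0 else 1
  have hD : D.det = C (Matrix.det (Matrix.of fun k c : Fin d => L c (X ^ (k : ℕ)))) := by
    rw [RingHom.map_det, det_snoc_aux d _ D 1, mul_one]
    · intro i j; simp [D]
    · intro j; simp [D]
    · simp [D]
  have hlin : ∀ (p : K[X]) (c : ℕ), (∀ k, d ≤ k → p.coeff k = 0) →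
      L c p = ∑ k : Fin d, p.coeff k * L c (X ^ (k : ℕ)) := by
    intro p c hp
    have : p = ∑ k : Fin d, p.coeff k • X ^ (k : ℕ) := by
      rw [← Finset.sum_range (fun k => p.coeff k • (X : K[X]) ^ k)]
      ext k
      simp only [finset_sum_coeff, coeff_smul, coeff_X_pow, smul_eq_mul, mul_ite, mul_one, mul_zero]
      rw [Finset.sum_ite_eq]
      split_ifs with h
      · rfl
      · exact hp _ (by simpa using h)
    conv_lhs => rw [this, map_sum]
    simp
  have hRdeg : ∀ p k, d ≤ k → (p %ₘ f).coeff k = 0 := by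
    intro p k hk
    apply coeff_eq_zero_of_degree_lt
    refine (degree_modByMonic_lt _ hf).trans_le ?_
    rw [degree_eq_natDegree hf.ne_zero, hfd]; exact_mod_cast hk
  have hLmod : ∀ p c, L c (p %ₘ f) = L c p := by
    intro p c
    conv_rhs => rw [← modByMonic_add_div p f, map_add, mul_comm, hL, add_zero]
  have hfac : absM L g d t = redM f g d t * D := by
    ext1 r c
    rw [Matrix.mul_apply, Fin.sum_univ_castSucc]
    by_cases hc : (c : ℕ) < d
    · simp only [absM, redM, D, Matrix.of_apply, hc, Fin.val_castSucc, Fin.is_lt, if_true,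
        Fin.val_last, lt_irrefl, if_false, mul_zero, add_zero]
      simp only [← C_mul, ← map_sum]
      split_ifs with hr
      · rw [hlin]
        intro k hk
        rw [coeff_X_pow, if_neg (by omega)]
      · rw [← hlin _ _ (hRdeg _), hLmod]
    · simp [absM, redM, D, hc]
  rw [hfac, Matrix.det_mul, hD, mul_comm]

lemma red_det {K : Type*} [Field K] (f g : K[X]) (d t : ℕ)
    (hf : f.Monic) (hfd : f.natDegree = d) (htd : t < d) :
    (redM f g d t).det = (-1) ^ (d - t) * Matrix.det (Matrix.of fun i c : Fin (d - t) =>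
      if (c : ℕ) = d - t - 1 then (X ^ (d - t - 1 - (i : ℕ)) * g) %ₘ f
      else C (((X ^ (d - t - 1 - (i : ℕ)) * g) %ₘ f).coeff (d - 1 - (c : ℕ)))) := by
  have hRdeg : ∀ p k, d ≤ k → (p %ₘ f).coeff k = 0 := by
    intro p k hk
    apply coeff_eq_zero_of_degree_lt
    refine (degree_modByMonic_lt _ hf).trans_le ?_
    rw [degree_eq_natDegree hf.ne_zero, hfd]; exact_mod_cast hk
  have hlin : ∀ (p : K[X]), (∀ k, d ≤ k → p.coeff k = 0) →
      ∑ k : Fin d, C (p.coeff k) * X ^ (k : ℕ) = p := by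
    intro p hp
    rw [← Finset.sum_range (fun k => C (p.coeff k) * (X : K[X]) ^ k)]
    ext k
    simp only [finset_sum_coeff, coeff_C_mul, coeff_X_pow, mul_ite, mul_one, mul_zero]
    rw [Finset.sum_ite_eq]
    split_ifs with h
    · rfl
    · exact (hp _ (by simpa using h)).symm
  have h := Matrix.det_updateCol_sum (redM f g d t) (Fin.last d)
    (fun k => if (k : ℕ) < d then -X ^ (k : ℕ) else 1)
  simp only [Fin.val_last, lt_irrefl, if_false, one_smul] at h
  rw [← h]
  set M2 := (redM f g d t).updateCol (Fin.last d)
    (fun k => ∑ j : Fin (d + 1), (if (j : ℕ) < d then -(X : K[X]) ^ (j : ℕ) else 1) • redM f g d t k j)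
    with hM2
  have hlast : ∀ r : Fin (d + 1), M2 r (Fin.last d) =
      if (r : ℕ) < t + 1 then 0 else -((X ^ ((r : ℕ) - (t + 1)) * g) %ₘ f) := by
    intro r
    rw [hM2, Matrix.updateCol_self, Fin.sum_univ_castSucc]
    simp only [redM, Matrix.of_apply, Fin.val_castSucc, Fin.is_lt, if_true,
        Fin.val_last, lt_irrefl, if_false, smul_eq_mul, one_mul, neg_mul, Finset.sum_neg_distrib]
    simp only [mul_comm (X ^ _) (C _)]
    split_ifs with hr
    · rw [hlin]
      · simp
      · intro k hk
        rw [coeff_X_pow, if_neg (by omega)]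
    · rw [hlin _ (hRdeg _), add_zero]
  have hoth : ∀ r c : Fin (d + 1), (c : ℕ) < d → M2 r c =
      C ((if (r : ℕ) < t + 1 then X ^ (r : ℕ)
        else (X ^ ((r : ℕ) - (t + 1)) * g) %ₘ f).coeff c) := by
    intro r c hc
    rw [hM2, Matrix.updateCol_ne (by rintro rfl; simp at hc)]
    simp [redM, hc]
  have hsz : (d - t) + (t + 1) = d + 1 := by omega
  let E : Fin (d - t) ⊕ Fin (t + 1) ≃ Fin (d + 1) :=
    (finSumFinEquiv.trans (finCongr hsz)).trans Fin.revPerm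
  have El : ∀ k, ((E (Sum.inl k) : Fin _) : ℕ) = d - k := fun k => by simp [E, Fin.val_rev]
  have Er : ∀ k, ((E (Sum.inr k) : Fin _) : ℕ) = t - k := fun k => by
    have := k.2
    simp [E, Fin.val_rev]; omega
  rw [← Matrix.det_submatrix_equiv_self E]
  have hblk : M2.submatrix E E = Matrix.fromBlocks
      (Matrix.of fun i c : Fin (d - t) => M2 (E (Sum.inl i)) (E (Sum.inl c)))
      (Matrix.of fun (i : Fin (d - t)) (c : Fin (t + 1)) => M2 (E (Sum.inl i)) (E (Sum.inr c)))
      0 1 := by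
    ext1 i c
    rcases i with i | i <;> rcases c with c | c
    · rfl
    · rfl
    · simp only [Matrix.submatrix_apply, Matrix.fromBlocks_apply₂₁, Matrix.zero_apply]
      have := i.2
      have := c.2
      by_cases hc : (c : ℕ) = 0
      · have : E (Sum.inl c) = Fin.last d := by ext; rw [El]; simp [hc]
        rw [this, hlast, Er, if_pos (by omega)]
      · rw [hoth _ _ (by rw [El]; omega), El, Er, if_pos (by omega), coeff_X_pow,
          if_neg (by omega), C_0]
    · simp only [Matrix.submatrix_apply, Matrix.fromBlocks_apply₂₂, Matrix.one_apply]
      have := i.2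
      have := c.2
      rw [hoth _ _ (by rw [Er]; omega), Er, Er, if_pos (by omega), coeff_X_pow]
      by_cases hic : i = c
      · simp [hic]
      · have : (i : ℕ) ≠ c := fun h => hic (Fin.ext h)
        rw [if_neg (by omega), if_neg hic, C_0]
  rw [hblk, Matrix.det_fromBlocks_zero₂₁, Matrix.det_one, mul_one]
  obtain ⟨n, hn⟩ : ∃ n, d - t = n + 1 := ⟨d - t - 1, by omega⟩
  -- generalise the size
  have gen : ∀ (N : ℕ) (A B : Matrix (Fin N) (Fin N) K[X]), N = n + 1 →
      (∀ i c c' : Fin N, (c : ℕ) = n → (c' : ℕ) = 0 → A i c' = - B i c) →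
      (∀ i c c' : Fin N, (c : ℕ) < n → (c' : ℕ) = c + 1 → A i c' = B i c) →
      A.det = (-1) ^ N * B.det := by
    rintro N A B rfl h1 h2
    have hA : A.submatrix id (finRotate (n + 1)) =
        B.updateCol (Fin.last n) ((-1 : K[X]) • fun i => B i (Fin.last n)) := by
      ext1 i c
      rw [Matrix.submatrix_apply]
      rcases Fin.eq_castSucc_or_eq_last c with ⟨c, rfl⟩ | rfl
      · rw [Matrix.updateCol_ne (Fin.castSucc_lt_last c).ne]
        exact h2 _ _ _ (by simp) (by simp)
      · rw [Matrix.updateCol_self]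
        simpa using h1 i (Fin.last n) _ (by simp) (by simp)
    have h3 := congrArg Matrix.det hA
    rw [Matrix.det_permute', Matrix.det_updateCol_smul, sign_finRotate] at h3
    have h4 : B.updateCol (Fin.last n) (fun i => B i (Fin.last n)) = B :=
      Matrix.updateCol_eq_self B (Fin.last n)
    rw [h4] at h3
    push_cast at h3
    have h5 : ((-1 : K[X]) ^ n) * (-1) ^ n = 1 := by
      rw [← mul_pow]; simp
    calc A.det = ((-1 : K[X]) ^ n * (-1) ^ n) * A.det := by rw [h5, one_mul]
      _ = (-1) ^ n * ((-1) ^ n * A.det) := by ring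
      _ = _ := by rw [h3]; ring
  apply gen _ _ _ hn
  · intro i c c' hc hc'
    have := i.2
    have e1 : E (Sum.inl c') = Fin.last d := by ext; rw [El]; simp [hc']
    simp only [Matrix.of_apply]
    rw [e1, hlast, El, if_neg (by omega), if_pos (by omega),
      show d - (i : ℕ) - (t + 1) = d - t - 1 - i by omega]
  · intro i c c' hc hc'
    have := i.2
    simp only [Matrix.of_apply]
    rw [hoth _ _ (by rw [El]; omega), El, El, if_neg (by omega), if_neg (by omega),
      show d - (i : ℕ) - (t + 1) = d - t - 1 - i by omega,
      show d - (c' : ℕ) = d - 1 - c by omega]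

lemma abs_main {K : Type*} [Field K] (L : ℕ → K[X] →ₗ[K] K) (f g : K[X]) (d e t : ℕ)
    (hf : f.Monic) (hfd : f.natDegree = d) (hge : g.natDegree ≤ e)
    (hL : ∀ c q, L c (q * f) = 0)
    (hcase : (t ≤ d ∧ d < e) ∨ (t < d ∧ d = e)) :
    C (Matrix.det (Matrix.of fun k c : Fin d => L c (X ^ (k : ℕ)))) * Sres f g d e t =
      (-1) ^ (d - t) * (absM L g d t).det := by
  by_cases htd : t < d
  · rw [sres_eq_rem f g d e t hf hfd hge htd (by omega), abs_factor L f g d t hf hfd hL htd,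
      red_det f g d t hf hfd htd]
    have h5 : ((-1 : K[X]) ^ (d - t)) * (-1) ^ (d - t) = 1 := by
      rw [← mul_pow]; simp
    linear_combination (-C (Matrix.det (Matrix.of fun k c : Fin d => L c (X ^ (k : ℕ)))) *
      Matrix.det (Matrix.of fun i c : Fin (d - t) =>
      if (c : ℕ) = d - t - 1 then (X ^ (d - t - 1 - (i : ℕ)) * g) %ₘ f
      else C (((X ^ (d - t - 1 - (i : ℕ)) * g) %ₘ f).coeff (d - 1 - (c : ℕ))))) * h5
  · obtain rfl : t = d := by omega
    rw [sres_top f g t e hf hfd (by omega), abs_top L f g t hf hfd hL]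
    simp

/-- The functional attached to column `c`. -/
noncomputable def colL {K : Type*} [Field K] {m : ℕ} (α : Fin m → K) (dd : Fin m → ℕ) (c : ℕ) :
    K[X] →ₗ[K] K :=
  ∑ p : Σ i, Fin (dd i), if (sigmaToFin dd p : ℕ) = c then
    ((((p.2 : ℕ)).factorial : K)⁻¹ • ((Polynomial.leval (α p.1)).comp
      ((Polynomial.derivative : K[X] →ₗ[K] K[X]) ^ (p.2 : ℕ)))) else 0

lemma colL_apply {K : Type*} [Field K] {m : ℕ} (α : Fin m → K) (dd : Fin m → ℕ) (c : ℕ)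
    (q : K[X]) : colL α dd c q = ∑ p : Σ i, Fin (dd i), if (sigmaToFin dd p : ℕ) = c then
      (((p.2 : ℕ)).factorial : K)⁻¹ * Polynomial.eval (α p.1)
        (Polynomial.derivative^[(p.2 : ℕ)] q) else 0 := by
  unfold colL
  rw [LinearMap.sum_apply]
  refine Finset.sum_congr rfl fun p _ => ?_
  split_ifs
  · simp [Module.End.pow_apply]
  · rfl

lemma dcoef_eq {K : Type*} [Field K] [CharZero K] (k j : ℕ) (a : K) :
    dcoef k j a = ((j.factorial : K))⁻¹ * Polynomial.eval a
      (Polynomial.derivative^[j] (X ^ k)) := by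
  unfold dcoef
  rw [iterate_derivative_X_pow_eq_natCast_mul]
  have hj : (j.factorial : K) ≠ 0 := by exact_mod_cast j.factorial_ne_zero
  simp only [eval_mul, eval_natCast, eval_pow, eval_X]
  rw [Nat.descFactorial_eq_factorial_mul_choose]
  push_cast
  split_ifs with h
  · field_simp
  · rw [Nat.choose_eq_zero_of_lt (by omega)]; simp

/-- `det V(Ā) ⬝ Sres_t(f̄,ḡ) = (-1)^{d-t} det M`, where `M` is the `(d+1)×(d+1)` matrix
whose first `t+1` rows are `[V_{t+1}(Ā) | (1,x,…,x^t)ᵀ]` and whose last `d-t` rows are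
`[W_{ḡ,d-t}(Ā) | 0]`. -/
theorem sres_vdm_wronskian {K : Type*} [Field K] [CharZero K] {m n : ℕ}
    (α : Fin m → K) (β : Fin n → K)
    (hα : Function.Injective α) (hβ : Function.Injective β)
    (dd : Fin m → ℕ) (ee : Fin n → ℕ) (hdd : ∀ i, 1 ≤ dd i) (hee : ∀ j, 1 ≤ ee j)
    (d e t : ℕ) (hd : d = ∑ i, dd i) (he : e = ∑ j, ee j)
    (hcase : (t ≤ d ∧ d < e) ∨ (t < d ∧ d = e)) :
    Polynomial.C (confVdm α dd).det *
        Sres (∏ i, (X - Polynomial.C (α i)) ^ (dd i))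
          (∏ j, (X - Polynomial.C (β j)) ^ (ee j)) d e t =
      (-1 : Polynomial K) ^ (d - t) *
        Matrix.det (Matrix.of fun r c : Fin (d + 1) =>
          if (r : ℕ) < t + 1 then
            if (c : ℕ) < d then
              ∑ p : Σ i, Fin (dd i),
                if (sigmaToFin dd p : ℕ) = (c : ℕ) then
                  Polynomial.C (dcoef (r : ℕ) (p.2 : ℕ) (α p.1))
                else 0
            else X ^ (r : ℕ)
          else
            if (c : ℕ) < d then
              ∑ p : Σ i, Fin (dd i),
                if (sigmaToFin dd p : ℕ) = (c : ℕ) then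
                  Polynomial.C ((((p.2 : ℕ)).factorial : K)⁻¹ *
                    Polynomial.eval (α p.1)
                      (Polynomial.derivative^[(p.2 : ℕ)]
                        (X ^ ((r : ℕ) - (t + 1)) *
                          ∏ j, (X - Polynomial.C (β j)) ^ (ee j))))
                else 0
            else 0) := by
  subst hd
  have hf : (∏ i, (X - Polynomial.C (α i)) ^ (dd i)).Monic :=
    monic_prod_of_monic _ _ fun i _ => (monic_X_sub_C _).pow _
  have hfd : (∏ i, (X - Polynomial.C (α i)) ^ (dd i)).natDegree = ∑ i, dd i := by
    rw [natDegree_prod_of_monic _ _ fun i _ => (monic_X_sub_C _).pow _]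
    simp
  have hge : (∏ j, (X - Polynomial.C (β j)) ^ (ee j)).natDegree ≤ e := by
    rw [natDegree_prod_of_monic _ _ fun i _ => (monic_X_sub_C _).pow _]
    simp [he]
  have hL : ∀ c q, colL α dd c (q * ∏ i, (X - Polynomial.C (α i)) ^ (dd i)) = 0 := by
    intro c q
    rw [colL_apply]
    refine Finset.sum_eq_zero fun p _ => ?_
    split_ifs
    · have h1 : (X - Polynomial.C (α p.1)) ^ (dd p.1) ∣
          q * ∏ i, (X - Polynomial.C (α i)) ^ (dd i) :=
        (Finset.dvd_prod_of_mem (fun i => (X - Polynomial.C (α i)) ^ (dd i))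
          (Finset.mem_univ p.1)).mul_left q
      have h2 := pow_sub_dvd_iterate_derivative_of_pow_dvd (p.2 : ℕ) h1
      have h3 : (X - Polynomial.C (α p.1)) ∣ Polynomial.derivative^[(p.2 : ℕ)]
          (q * ∏ i, (X - Polynomial.C (α i)) ^ (dd i)) :=
        (dvd_pow_self _ (by have := p.2.2; omega)).trans h2
      rw [(dvd_iff_isRoot.mp h3).eq_zero, mul_zero]
    · rfl
  have main := abs_main (colL α dd) _ _ _ e t hf hfd hge hL hcase
  convert main using 3
  · congr 1
    ext1 k c
    simp only [confVdm, Matrix.of_apply, colL_apply, dcoef_eq]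
  · ext1 r c
    simp only [absM, Matrix.of_apply, colL_apply, dcoef_eq, map_sum, apply_ite Polynomial.C,
      Polynomial.C_0]
end
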